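/- arXiv:2311.15666 — 2 statements merged into one kernel-verified Lean document; each statement's English description precedes it below -/
import Mathlib

section
/- Σ_{n=1}^∞ (−1)^n n^5 / sinh(nπ)^3 = −5Γ^8/(2^10 π^8) + Γ^16/(2^16 π^12), where Γ = Γ(1/4). -/
open Real

section

open UpperHalfPlane hiding I
open Filter Topology
open scoped Manifold MatrixGroups ModularForm CongruenceSubgroup ArithmeticFunction.sigma
open MeasureTheory Set Derivative PeriodPair

/-- A power series in `q = exp (2πiτ)` tends to its constant coefficient as `τ → i∞`. -/
lemma tendsto_atImInfty_of_hasSum_qExpansion {f : ℍ → ℂ} {c : ℕ → ℂ}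
    (hf : ∀ τ : ℍ, HasSum (fun m ↦ c m * Complex.exp (2 * π * Complex.I * τ) ^ m) (f τ)) :
    Tendsto f atImInfty (𝓝 (c 0)) := by
  have hq : Tendsto (fun τ : ℍ ↦ Complex.exp (2 * π * Complex.I * τ)) atImInfty (𝓝 0) := by
    simpa [Function.Periodic.qParam] using qParam_tendsto_atImInfty one_pos
  have hI := (hf UpperHalfPlane.I).summable.norm
  have hfe : f = fun τ : ℍ ↦ ∑' m, c m * Complex.exp (2 * π * Complex.I * τ) ^ m :=
    funext fun τ ↦ (hf τ).tsum_eq.symm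
  have h0 : c 0 = ∑' m : ℕ, c m * (0 : ℂ) ^ m := by
    rw [tsum_eq_single 0 (fun m hm ↦ by simp [hm])]; simp
  rw [hfe, h0]
  refine tendsto_tsum_of_dominated_convergence hI
    (fun m ↦ (hq.pow m).const_mul (c m)) ?_
  filter_upwards [atImInfty_basis.mem_of_mem (i := 1) trivial] with τ hτ m
  rw [norm_mul, norm_mul, norm_pow, norm_pow]
  gcongr
  rw [Complex.norm_exp, Complex.norm_exp]
  have : (1 : ℝ) ≤ τ.im := hτ
  simp
  nlinarith [pi_pos]

/-- Termwise differentiation of `q`-expansions. -/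
lemma hasSum_normalizedDerivOfComplex {f : ℍ → ℂ} {c : ℕ → ℂ}
    (hf : ∀ τ : ℍ, HasSum (fun m ↦ c m * Complex.exp (2 * π * Complex.I * τ) ^ m) (f τ)) (τ : ℍ) :
    HasSum (fun m ↦ m * c m * Complex.exp (2 * π * Complex.I * τ) ^ m)
      (Derivative.normalizedDerivOfComplex f τ) := by
  let U : Set ℂ := {w | τ.im / 2 < w.im}
  have hU : IsOpen U := isOpen_lt continuous_const Complex.continuous_im
  have hτU : (τ : ℂ) ∈ U := by
    have := τ.im_pos
    simp only [U, Set.mem_ofPred_eq, coe_im]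
    linarith
  let τ' : ℍ := ⟨(τ.im / 2 : ℝ) * Complex.I, by simpa using τ.im_pos⟩
  have hd (m : ℕ) (w : ℂ) : HasDerivAt (fun w ↦ c m * Complex.exp (2 * π * Complex.I * w) ^ m)
      ((2 * π * Complex.I) * (m * c m * Complex.exp (2 * π * Complex.I * w) ^ m)) w := by
    have h1 : HasDerivAt (fun w : ℂ ↦ 2 * π * Complex.I * w) (2 * π * Complex.I) w := by
      simpa using (hasDerivAt_id w).const_mul (2 * π * Complex.I)
    have := ((h1.cexp).pow m).const_mul (c m)
    refine this.congr_deriv ?_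
    rcases m with _ | m
    · simp
    · simp only [Nat.cast_add, Nat.cast_one, Nat.add_sub_cancel, pow_succ]
      ring
  have key := Complex.hasSum_deriv_of_summable_norm (hf τ').summable.norm (U := U)
    (F := fun m w ↦ c m * Complex.exp (2 * π * Complex.I * w) ^ m)
    (fun m w _ ↦ (hd m w).differentiableAt.differentiableWithinAt) hU
    (fun m w hw ↦ by
      rw [norm_mul, norm_mul, norm_pow, norm_pow]
      gcongr
      rw [Complex.norm_exp, Complex.norm_exp]
      have : τ.im / 2 < w.im := hw
      simp [τ']
      nlinarith [pi_pos]) hτU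
  have hev : (f ∘ ofComplex) =ᶠ[𝓝 (τ : ℂ)]
      fun w ↦ ∑' m : ℕ, c m * Complex.exp (2 * π * Complex.I * w) ^ m := by
    filter_upwards [isOpen_upperHalfPlaneSet.mem_nhds τ.im_pos] with w hw
    have := (hf ⟨w, hw⟩).tsum_eq
    simp only [Function.comp_apply, ofComplex_apply_of_im_pos hw]
    exact this.symm
  rw [Derivative.normalizedDerivOfComplex, hev.deriv_eq]
  have key' := key.mul_left (2 * π * Complex.I)⁻¹
  simp only [fun m ↦ (hd m τ).deriv, inv_mul_cancel_left₀ Complex.two_pi_I_ne_zero] at key'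
  exact key'

/-- A level one form of weight less than `12` which vanishes at `i∞` is zero. -/
lemma eq_zero_of_isZeroAtImInfty_of_weight_lt_twelve {k : ℤ} (hk : k < 12) {f : ℍ → ℂ}
    (hf : MDiff f) (hslash : ∀ γ : SL(2, ℤ), f ∣[k] γ = f) (h0 : Tendsto f atImInfty (𝓝 0)) :
    f = 0 := by
  let F : CuspForm 𝒮ℒ k :=
    { toFun := f
      slash_action_eq' := fun _ ⟨γ, hγ⟩ ↦ hγ ▸ hslash γ
      holo' := hf
      zero_at_cusps' {c} hc := by
        rw [Subgroup.IsArithmetic.isCusp_iff_isCusp_SL2Z] at hc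
        rw [OnePoint.isZeroAt_iff_forall_SL2Z hc]
        intro γ _
        rw [hslash γ]
        exact h0 }
  have hF : F = 0 := rank_zero_iff_forall_zero.mp (CuspForm.rank_eq_zero_of_weight_lt_twelve hk) F
  exact congrArg (fun G : CuspForm 𝒮ℒ k ↦ (G : ℍ → ℂ)) hF

lemma hasSum_E₄ (τ : ℍ) : HasSum (fun m : ℕ ↦ (if m = 0 then 1 else 240 * (σ 3 m : ℂ)) *
    Complex.exp (2 * π * Complex.I * τ) ^ m) (ModularForm.E₄ τ) := by
  have := ModularForm.hasSum_qExpansion ModularForm.E₄ one_pos one_mem_strictPeriods_SL τ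
  norm_num [EisensteinSeries.E_qExpansion_coeff _ ⟨2, rfl⟩,
    bernoulli_eq_bernoulli'_of_ne_one, bernoulli'_four, Function.Periodic.qParam] at this
  simpa using this

lemma bernoulli_six : bernoulli 6 = 1 / 42 := by
  rw [bernoulli_eq_bernoulli'_of_ne_one (by norm_num), bernoulli'_def]
  have h5 : bernoulli' 5 = 0 := bernoulli'_eq_zero_of_odd (by decide) (by norm_num)
  norm_num [Finset.sum_range_succ, h5, Nat.choose]

lemma hasSum_E₆ (τ : ℍ) : HasSum (fun m : ℕ ↦ (if m = 0 then 1 else -504 * (σ 5 m : ℂ)) *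
    Complex.exp (2 * π * Complex.I * τ) ^ m) (ModularForm.E₆ τ) := by
  have := ModularForm.hasSum_qExpansion ModularForm.E₆ one_pos one_mem_strictPeriods_SL τ
  norm_num [EisensteinSeries.E_qExpansion_coeff _ ⟨3, rfl⟩,
    bernoulli_six, Function.Periodic.qParam] at this
  simpa using this

lemma hasSum_E2 (τ : ℍ) : HasSum (fun m : ℕ ↦ (if m = 0 then 1 else -24 * (σ 1 m : ℂ)) *
    Complex.exp (2 * π * Complex.I * τ) ^ m) (EisensteinSeries.E2 τ) := by
  simpa using EisensteinSeries.hasSum_qExpansion_E2 (z := τ)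

/-- The failure of `D E₂ - E₂² / 12` to be a Serre derivative is compensated by the
quasi-modularity of `E₂`, so that it is modular of weight four. -/
lemma E2_ramanujan_slash (γ : SL(2, ℤ)) :
    (normalizedDerivOfComplex EisensteinSeries.E2 -
      (12⁻¹ : ℂ) • (EisensteinSeries.E2 * EisensteinSeries.E2)) ∣[(4 : ℤ)] γ =
    normalizedDerivOfComplex EisensteinSeries.E2 -
      (12⁻¹ : ℂ) • (EisensteinSeries.E2 * EisensteinSeries.E2) := by
  have h1 := normalizedDerivOfComplex_SL_slash (k := 2) E2_mdifferentiable (γ := γ)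
  have h2 := EisensteinSeries.E2_slash_action γ
  ext z
  have hd : HasDerivAt (fun w ↦ 1 / (2 * riemannZeta 2) *
      (2 * π * Complex.I * γ 1 0 * denom (γ : GL (Fin 2) ℝ) w ^ (-1 : ℤ)))
      (1 / (2 * riemannZeta 2) * (2 * π * Complex.I * γ 1 0 *
        (-γ 1 0 * denom γ z ^ (-2 : ℤ)))) (z : ℂ) := by
    have := ((hasDerivAt_denom_zpow (γ : GL (Fin 2) ℝ) (-1) z).const_mul
      (2 * π * Complex.I * γ 1 0)).const_mul (1 / (2 * riemannZeta 2))
    refine this.congr_deriv ?_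
    simp
  have h3 : normalizedDerivOfComplex (EisensteinSeries.E2 ∣[(2 : ℤ)] γ) z =
      normalizedDerivOfComplex EisensteinSeries.E2 z +
        (1 / (2 * riemannZeta 2)) * (γ 1 0 / denom γ z) ^ 2 := by
    have hev : ((EisensteinSeries.E2 ∣[(2 : ℤ)] γ) ∘ ofComplex) =ᶠ[𝓝 (z : ℂ)]
        fun w ↦ (EisensteinSeries.E2 ∘ ofComplex) w - 1 / (2 * riemannZeta 2) *
          (2 * π * Complex.I * γ 1 0 * denom (γ : GL (Fin 2) ℝ) w ^ (-1 : ℤ)) := by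
      filter_upwards [isOpen_upperHalfPlaneSet.mem_nhds z.im_pos] with w hw
      simp [h2, EisensteinSeries.D2, ofComplex_apply_of_im_pos hw, div_eq_mul_inv]
    rw [normalizedDerivOfComplex, hev.deriv_eq,
      ((mdifferentiableAt_iff.mp (E2_mdifferentiable z)).hasDerivAt.fun_sub hd).deriv,
      normalizedDerivOfComplex]
    have hz := denom_ne_zero γ z
    have hpi := Complex.two_pi_I_ne_zero
    rw [mul_sub, sub_eq_add_neg]
    congr 1
    simp only [zpow_neg]
    field_simp
  have h1z := congrFun h1 z
  have h4 := congrFun (ModularForm.mul_slash_SL2 2 2 γ EisensteinSeries.E2 EisensteinSeries.E2) z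
  have h5 : ((normalizedDerivOfComplex EisensteinSeries.E2 -
      (12⁻¹ : ℂ) • (EisensteinSeries.E2 * EisensteinSeries.E2)) ∣[(4 : ℤ)] γ) z =
      (normalizedDerivOfComplex EisensteinSeries.E2 ∣[(4 : ℤ)] γ) z -
        12⁻¹ * ((EisensteinSeries.E2 * EisensteinSeries.E2) ∣[(4 : ℤ)] γ) z := by
    simp [ModularForm.SL_slash_apply]
    ring
  rw [h5]
  norm_num at h1z h4
  rw [h4, Pi.sub_apply, Pi.smul_apply, Pi.mul_apply]
  rw [h3] at h1z
  simp only [h2, Pi.sub_apply, Pi.smul_apply, smul_eq_mul, EisensteinSeries.D2,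
    riemannZeta_two] at h1z ⊢
  have hpi : (π : ℂ) ≠ 0 := by exact_mod_cast pi_ne_zero
  generalize hu : (γ 1 0 : ℂ) / denom γ z = u at h1z
  rw [mul_div_assoc, hu] at h1z ⊢
  rw [← sub_eq_iff_eq_add] at h1z
  rw [← h1z]
  field_simp
  ring_nf
  simp only [Complex.I_sq]
  ring

lemma tendsto_E₄ : Tendsto (ModularForm.E₄ : ℍ → ℂ) atImInfty (𝓝 1) := by
  simpa using tendsto_atImInfty_of_hasSum_qExpansion hasSum_E₄

lemma tendsto_E₆ : Tendsto (ModularForm.E₆ : ℍ → ℂ) atImInfty (𝓝 1) := by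
  simpa using tendsto_atImInfty_of_hasSum_qExpansion hasSum_E₆

lemma tendsto_E2 : Tendsto EisensteinSeries.E2 atImInfty (𝓝 1) := by
  simpa using tendsto_atImInfty_of_hasSum_qExpansion hasSum_E2

lemma tendsto_normalizedDerivOfComplex {f : ℍ → ℂ} {c : ℕ → ℂ}
    (hf : ∀ τ : ℍ, HasSum (fun m ↦ c m * Complex.exp (2 * π * Complex.I * τ) ^ m) (f τ)) :
    Tendsto (normalizedDerivOfComplex f) atImInfty (𝓝 0) := by
  simpa using tendsto_atImInfty_of_hasSum_qExpansion (hasSum_normalizedDerivOfComplex hf)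

lemma slash_E₄ (γ : SL(2, ℤ)) : (ModularForm.E₄ : ℍ → ℂ) ∣[(4 : ℤ)] γ = ModularForm.E₄ :=
  ModularForm.E₄.slash_action_eq' _ ⟨γ, rfl⟩

lemma slash_E₆ (γ : SL(2, ℤ)) : (ModularForm.E₆ : ℍ → ℂ) ∣[(6 : ℤ)] γ = ModularForm.E₆ :=
  ModularForm.E₆.slash_action_eq' _ ⟨γ, rfl⟩

lemma slash_smul (k : ℤ) (γ : SL(2, ℤ)) (c : ℂ) (f : ℍ → ℂ) :
    (c • f) ∣[k] γ = c • (f ∣[k] γ) := by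
  ext z
  simp [ModularForm.SL_slash_apply, mul_assoc]

lemma slash_sub (k : ℤ) (γ : SL(2, ℤ)) (f g : ℍ → ℂ) :
    (f - g) ∣[k] γ = f ∣[k] γ - g ∣[k] γ := by
  ext z
  simp [ModularForm.SL_slash_apply, sub_mul]

/-- Ramanujan's identity for `D E₂`. -/
lemma ramanujan_E2 : normalizedDerivOfComplex EisensteinSeries.E2 =
    (12⁻¹ : ℂ) • (EisensteinSeries.E2 * EisensteinSeries.E2 - ModularForm.E₄) := by
  have h4 : MDiff (ModularForm.E₄ : ℍ → ℂ) := ModularForm.E₄.holo'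
  have := eq_zero_of_isZeroAtImInfty_of_weight_lt_twelve (k := 4) (by norm_num)
    (f := normalizedDerivOfComplex EisensteinSeries.E2 -
      (12⁻¹ : ℂ) • (EisensteinSeries.E2 * EisensteinSeries.E2) - (-12⁻¹ : ℂ) • ModularForm.E₄)
    (((normalizedDerivOfComplex_mdifferentiable E2_mdifferentiable).sub
      ((E2_mdifferentiable.mul E2_mdifferentiable).const_smul _)).sub (h4.const_smul _))
    (fun γ ↦ by rw [slash_sub, E2_ramanujan_slash, slash_smul, slash_E₄])
    (by
      have := ((tendsto_normalizedDerivOfComplex hasSum_E2).sub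
        ((tendsto_E2.mul tendsto_E2).const_smul (12⁻¹ : ℂ))).sub
        (tendsto_E₄.const_smul (-12⁻¹ : ℂ))
      convert this using 2
      · rfl
      · norm_num)
  ext z
  have := congrFun this z
  simp at this ⊢
  linear_combination this

/-- Ramanujan's identity for `D E₄`. -/
lemma ramanujan_E₄ : normalizedDerivOfComplex (ModularForm.E₄ : ℍ → ℂ) =
    (3⁻¹ : ℂ) • (EisensteinSeries.E2 * ModularForm.E₄ - ModularForm.E₆) := by
  have h4 : MDiff (ModularForm.E₄ : ℍ → ℂ) := ModularForm.E₄.holo'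
  have h6 : MDiff (ModularForm.E₆ : ℍ → ℂ) := ModularForm.E₆.holo'
  have := eq_zero_of_isZeroAtImInfty_of_weight_lt_twelve (k := 6) (by norm_num)
    (f := serreDerivative (4 : ℤ) ModularForm.E₄ - (-3⁻¹ : ℂ) • ModularForm.E₆)
    ((serreDerivative_mdifferentiable _ h4).sub (h6.const_smul _))
    (fun γ ↦ by rw [slash_sub, slash_smul, slash_E₆]; congr 1; exact
      serreDerivative_slash_invariant h4 (slash_E₄ γ))
    (by
      have := ((tendsto_normalizedDerivOfComplex hasSum_E₄).sub
        ((tendsto_E2.const_mul ((4 : ℤ) * 12⁻¹ : ℂ)).mul tendsto_E₄)).sub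
        (tendsto_E₆.const_smul (-3⁻¹ : ℂ))
      convert this using 2
      · rfl
      · norm_num)
  ext z
  have := congrFun this z
  simp at this ⊢
  linear_combination this

/-- Ramanujan's identity for `D E₆`. -/
lemma ramanujan_E₆ : normalizedDerivOfComplex (ModularForm.E₆ : ℍ → ℂ) =
    (2⁻¹ : ℂ) • (EisensteinSeries.E2 * ModularForm.E₆ - ModularForm.E₄ * ModularForm.E₄) := by
  have h4 : MDiff (ModularForm.E₄ : ℍ → ℂ) := ModularForm.E₄.holo'
  have h6 : MDiff (ModularForm.E₆ : ℍ → ℂ) := ModularForm.E₆.holo'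
  have := eq_zero_of_isZeroAtImInfty_of_weight_lt_twelve (k := 8) (by norm_num)
    (f := serreDerivative (6 : ℤ) ModularForm.E₆ -
      (-2⁻¹ : ℂ) • ((ModularForm.E₄ : ℍ → ℂ) * ModularForm.E₄))
    ((serreDerivative_mdifferentiable _ h6).sub ((h4.mul h4).const_smul _))
    (fun γ ↦ by
      rw [slash_sub, slash_smul, show (8 : ℤ) = 4 + 4 by rfl, ModularForm.mul_slash_SL2,
        slash_E₄, show (4 : ℤ) + 4 = 6 + 2 by rfl,
        serreDerivative_slash_invariant h6 (slash_E₆ γ)])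
    (by
      have := ((tendsto_normalizedDerivOfComplex hasSum_E₆).sub
        ((tendsto_E2.const_mul ((6 : ℤ) * 12⁻¹ : ℂ)).mul tendsto_E₆)).sub
        ((tendsto_E₄.mul tendsto_E₄).const_smul (-2⁻¹ : ℂ))
      convert this using 2
      · rfl
      · norm_num)
  ext z
  have := congrFun this z
  simp at this ⊢
  linear_combination this

/-- The second derivative of `E₄` at a zero of `E₆`. -/
lemma normalizedDerivOfComplex_normalizedDerivOfComplex_E₄ {z : ℍ} (hz : ModularForm.E₆ z = 0) :
    normalizedDerivOfComplex (normalizedDerivOfComplex (ModularForm.E₄ : ℍ → ℂ)) z =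
      5 / 36 * (EisensteinSeries.E2 z ^ 2 * ModularForm.E₄ z + ModularForm.E₄ z ^ 2) := by
  have h4 : MDiff (ModularForm.E₄ : ℍ → ℂ) := ModularForm.E₄.holo'
  have h6 : MDiff (ModularForm.E₆ : ℍ → ℂ) := ModularForm.E₆.holo'
  rw [ramanujan_E₄, normalizedDerivOfComplex_smul _ _ ((E2_mdifferentiable.mul h4).sub h6),
    normalizedDerivOfComplex_sub _ _ (E2_mdifferentiable.mul h4) h6,
    normalizedDerivOfComplex_mul _ _ E2_mdifferentiable h4, ramanujan_E₄, ramanujan_E2,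
    ramanujan_E₆]
  simp [hz]
  ring

/-- The point `(1 + i) / 2`. -/
noncomputable def halfOnePlusI : ℍ := ⟨(1 + Complex.I) / 2, by simp⟩

/-- The lower unipotent generator of `SL(2, ℤ)`, which maps `i` to `(1 + i) / 2`. -/
def lowerUnipotent : SL(2, ℤ) := ⟨!![1, 0; 1, 1], by simp⟩

lemma denom_lowerUnipotent : denom lowerUnipotent UpperHalfPlane.I = 1 + Complex.I := by
  rw [ModularGroup.denom_apply]
  simp [lowerUnipotent, add_comm]

lemma one_add_I_ne_zero : (1 + Complex.I) ≠ 0 := fun h ↦ by simpa using congrArg Complex.re h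

lemma lowerUnipotent_smul_I : lowerUnipotent • UpperHalfPlane.I = halfOnePlusI := by
  ext
  rw [UpperHalfPlane.specialLinearGroup_apply]
  have := one_add_I_ne_zero
  simp [lowerUnipotent, halfOnePlusI]
  rw [add_comm Complex.I]
  field_simp
  ring_nf
  simp

lemma slash_lowerUnipotent (k : ℤ) (f : ℍ → ℂ) :
    (f ∣[k] lowerUnipotent) UpperHalfPlane.I = f halfOnePlusI * (1 + Complex.I) ^ (-k) := by
  rw [ModularForm.SL_slash_apply, lowerUnipotent_smul_I, denom_lowerUnipotent]

lemma S_smul_I : ModularGroup.S • UpperHalfPlane.I = UpperHalfPlane.I := by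
  ext
  rw [UpperHalfPlane.specialLinearGroup_apply]
  simp [ModularGroup.S]

lemma slash_S_I (k : ℤ) (f : ℍ → ℂ) :
    (f ∣[k] ModularGroup.S) UpperHalfPlane.I = f UpperHalfPlane.I * Complex.I ^ (-k) := by
  rw [ModularForm.SL_slash_apply, S_smul_I, ModularGroup.denom_S, UpperHalfPlane.coe_I]

lemma E₆_I : ModularForm.E₆ UpperHalfPlane.I = 0 := by
  have h := slash_S_I 6 ModularForm.E₆
  rw [slash_E₆, show (Complex.I ^ (-6 : ℤ)) = -1 by
    rw [zpow_neg, zpow_ofNat, show 6 = 2 * 3 by rfl, pow_mul]; norm_num] at h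
  linear_combination h / 2

lemma E2_I : EisensteinSeries.E2 UpperHalfPlane.I = 3 / π := by
  have h := slash_S_I 2 EisensteinSeries.E2
  rw [EisensteinSeries.E2_slash_action, Pi.sub_apply, Pi.smul_apply, EisensteinSeries.D2_S,
    riemannZeta_two, UpperHalfPlane.coe_I] at h
  have hpi : (π : ℂ) ≠ 0 := by exact_mod_cast pi_ne_zero
  rw [show (Complex.I ^ (-2 : ℤ)) = -1 by norm_num [zpow_neg]] at h
  simp at h
  field_simp at h ⊢
  linear_combination h / 2

lemma one_add_I_sq : (1 + Complex.I) ^ 2 = 2 * Complex.I := by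
  linear_combination Complex.I_sq

lemma E₆_halfOnePlusI : ModularForm.E₆ halfOnePlusI = 0 := by
  have h := slash_lowerUnipotent 6 ModularForm.E₆
  rw [slash_E₆, E₆_I] at h
  have := one_add_I_ne_zero
  simpa [this] using h

lemma E₄_halfOnePlusI : ModularForm.E₄ halfOnePlusI = -4 * ModularForm.E₄ UpperHalfPlane.I := by
  have h := slash_lowerUnipotent 4 ModularForm.E₄
  rw [slash_E₄, zpow_neg, zpow_ofNat, show 4 = 2 * 2 by rfl, pow_mul, one_add_I_sq, mul_pow] at h
  norm_num at h
  linear_combination 4 * h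

lemma E2_halfOnePlusI : EisensteinSeries.E2 halfOnePlusI = 6 / π := by
  have h := slash_lowerUnipotent 2 EisensteinSeries.E2
  rw [EisensteinSeries.E2_slash_action, Pi.sub_apply, Pi.smul_apply, EisensteinSeries.D2,
    riemannZeta_two, E2_I, denom_lowerUnipotent, zpow_neg, zpow_ofNat, one_add_I_sq] at h
  have hpi : (π : ℂ) ≠ 0 := by exact_mod_cast pi_ne_zero
  have hI := one_add_I_ne_zero
  have h10 : lowerUnipotent 1 0 = 1 := rfl
  rw [h10] at h
  have hinv : (1 + Complex.I)⁻¹ = (1 - Complex.I) / 2 := by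
    refine inv_eq_of_mul_eq_one_right ?_
    linear_combination -Complex.I_sq / 2
  rw [div_eq_mul_inv _ (1 + Complex.I), hinv] at h
  simp at h
  field_simp at h ⊢
  ring_nf at h ⊢
  simp only [Complex.I_sq] at h
  linear_combination -Complex.I * h + (π * EisensteinSeries.E2 halfOnePlusI - 6) * Complex.I_sq

lemma summable_pow_mul_pow_mul_pow_mul (j k : ℕ) {q : ℂ} (hq : ‖q‖ < 1) :
    Summable fun c : ℕ+ × ℕ+ ↦ (c.1 : ℂ) ^ j * (c.2 : ℂ) ^ k * q ^ (c.1 * c.2 : ℕ) := by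
  obtain ⟨s, hs0, hs1, hqs⟩ : ∃ s : ℝ, 0 ≤ s ∧ s < 1 ∧ ‖q‖ = s ^ 2 :=
    ⟨√‖q‖, sqrt_nonneg _, by rwa [sqrt_lt' one_pos, one_pow], (sq_sqrt (norm_nonneg q)).symm⟩
  have hs (j : ℕ) : Summable fun n : ℕ+ ↦ (n : ℝ) ^ j * s ^ (n : ℕ) := by
    have h := summable_pow_mul_geometric_of_norm_lt_one j (by rwa [norm_of_nonneg hs0])
    exact h.comp_injective PNat.coe_injective
  have hb := (hs j).mul_of_nonneg (hs k) (fun _ ↦ by positivity) fun _ ↦ by positivity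
  refine Summable.of_norm_bounded hb fun c ↦ ?_
  obtain ⟨n, m⟩ := c
  simp only [norm_mul, norm_pow, Complex.norm_natCast, hqs]
  have h1 : (s ^ 2) ^ (n * m : ℕ) ≤ s ^ (n : ℕ) * s ^ (m : ℕ) := by
    rw [← pow_mul, ← pow_add]
    refine pow_le_pow_of_le_one hs0 hs1.le ?_
    have := n.pos
    have := m.pos
    nlinarith
  calc _ ≤ (n : ℝ) ^ j * (m : ℝ) ^ k * (s ^ (n : ℕ) * s ^ (m : ℕ)) := by gcongr
    _ = _ := by ring

lemma tsum_prod_pow_eq_tsum_sq_mul_sigma {q : ℂ} (hq : ‖q‖ < 1) :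
    ∑' n : ℕ+, ∑' m : ℕ+, (n : ℂ) ^ 5 * (m : ℂ) ^ 2 * q ^ (n * m : ℕ) =
      ∑' N : ℕ+, (N : ℂ) ^ 2 * (σ 3 N : ℂ) * q ^ (N : ℕ) := by
  have hs := summable_pow_mul_pow_mul_pow_mul 5 2 hq
  have hs' := sigmaAntidiagonalEquivProd.summable_iff.mpr hs
  simp only [Function.comp_def] at hs'
  rw [← hs.tsum_prod, ← sigmaAntidiagonalEquivProd.tsum_eq, hs'.tsum_sigma]
  refine tsum_congr fun N ↦ ?_
  simp only [sigmaAntidiagonalEquivProd, divisorsAntidiagonalFactors, PNat.mk_coe,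
    Equiv.coe_fn_mk, tsum_fintype, Finset.univ_eq_attach]
  rw [(N : ℕ).divisorsAntidiagonal.sum_attach
    (fun x : ℕ × ℕ ↦ (x.1 : ℂ) ^ 5 * (x.2 : ℂ) ^ 2 * q ^ (x.1 * x.2)),
    ArithmeticFunction.sigma_apply, Nat.sum_divisorsAntidiagonal
      (fun x y : ℕ ↦ (x : ℂ) ^ 5 * (y : ℂ) ^ 2 * q ^ (x * y)), Nat.cast_sum, Finset.mul_sum,
    Finset.sum_mul]
  refine Finset.sum_congr rfl fun d hd ↦ ?_
  have h1 : d * ((N : ℕ) / d) = N := Nat.mul_div_cancel' (Nat.dvd_of_mem_divisors hd)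
  have h2 : (N : ℂ) = d * ((N / d : ℕ) : ℂ) := by exact_mod_cast h1.symm
  rw [h1, h2, Nat.cast_pow]
  ring

lemma tsum_sq_mul_pow {x : ℂ} (hx : ‖x‖ < 1) :
    ∑' m : ℕ+, (m : ℂ) ^ 2 * x ^ (m : ℕ) = x * (1 + x) / (1 - x) ^ 3 := by
  have h1 := hasSum_choose_mul_geometric_of_norm_lt_one 1 hx
  have h2 := hasSum_choose_mul_geometric_of_norm_lt_one 2 hx
  have h3 := ((h2.mul_left 2).sub h1).mul_left x
  rw [tsum_pnat_eq_tsum_succ (f := fun m : ℕ ↦ (m : ℂ) ^ 2 * x ^ m)]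
  have hx1 : 1 - x ≠ 0 := by
    rw [sub_ne_zero]
    rintro rfl
    simp at hx
  convert h3.tsum_eq using 1
  · refine tsum_congr fun m ↦ ?_
    rw [Nat.cast_choose_two]
    push_cast
    ring_nf
    simp
    ring
  · field_simp
    ring

lemma tsum_pow_five_mul_odd_part {q : ℂ} (hq : ‖q‖ < 1) :
    ∑' n : ℕ+, (n : ℂ) ^ 5 * (8 * (q ^ (n : ℕ)) ^ 3 / (1 - (q ^ (n : ℕ)) ^ 2) ^ 3) =
      ∑' N : ℕ+, (N : ℂ) ^ 2 * (σ 3 N : ℂ) * q ^ (N : ℕ) - ∑' N : ℕ+, (σ 5 N : ℂ) * q ^ (N : ℕ) -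
      (4 * ∑' N : ℕ+, (N : ℂ) ^ 2 * (σ 3 N : ℂ) * (q ^ 2) ^ (N : ℕ) -
        ∑' N : ℕ+, (σ 5 N : ℂ) * (q ^ 2) ^ (N : ℕ)) := by
  have hq2 : ‖q ^ 2‖ < 1 := by
    rw [norm_pow]
    exact pow_lt_one₀ (norm_nonneg _) hq two_ne_zero
  have hA {q : ℂ} (hq : ‖q‖ < 1) : HasSum (fun n : ℕ+ ↦ (n : ℂ) ^ 5 *
      (q ^ (n : ℕ) * (1 + q ^ (n : ℕ)) / (1 - q ^ (n : ℕ)) ^ 3))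
      (∑' N : ℕ+, (N : ℂ) ^ 2 * (σ 3 N : ℂ) * q ^ (N : ℕ)) := by
    have hs := summable_pow_mul_pow_mul_pow_mul 5 2 hq
    rw [← tsum_prod_pow_eq_tsum_sq_mul_sigma hq]
    refine hs.prod.hasSum.congr_fun fun n ↦ ?_
    · rw [← tsum_sq_mul_pow (by rw [norm_pow]; exact pow_lt_one₀ (norm_nonneg _) hq n.ne_zero),
        ← tsum_mul_left]
      exact tsum_congr fun m ↦ by rw [pow_mul, mul_assoc]
  have hB {q : ℂ} (hq : ‖q‖ < 1) : HasSum (fun n : ℕ+ ↦ (n : ℂ) ^ 5 * q ^ (n : ℕ) /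
      (1 - q ^ (n : ℕ))) (∑' N : ℕ+, (σ 5 N : ℂ) * q ^ (N : ℕ)) := by
    rw [← tsum_pow_div_one_sub_eq_tsum_sigma hq 5]
    exact ((summable_norm_pow_mul_geometric_div_one_sub 5 hq).comp_injective
      PNat.coe_injective).hasSum
  have h := ((hA hq).sub (hB hq)).sub (((hA hq2).mul_left 4).sub (hB hq2))
  rw [← h.tsum_eq]
  refine tsum_congr fun n ↦ ?_
  have hx : ‖q ^ (n : ℕ)‖ < 1 := by rw [norm_pow]; exact pow_lt_one₀ (norm_nonneg _) hq n.ne_zero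
  rw [← pow_mul q 2, mul_comm 2, pow_mul q _ 2]
  generalize q ^ (n : ℕ) = x at hx
  have hx1 : 1 - x ≠ 0 := by
    rw [sub_ne_zero]
    rintro rfl
    simp at hx
  have hx2 : 1 + x ≠ 0 := by
    intro h
    rw [← norm_neg, neg_eq_of_add_eq_zero_left h, norm_one] at hx
    exact lt_irrefl _ hx
  have hx3 : 1 - x ^ 2 ≠ 0 := by
    rw [show 1 - x ^ 2 = (1 - x) * (1 + x) by ring]
    exact mul_ne_zero hx1 hx2
  rw [show 1 - x ^ 2 = (1 - x) * (1 + x) by ring]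
  field_simp
  ring

lemma tsum_sq_mul_sigma_three (z : ℍ) :
    ∑' N : ℕ+, (N : ℂ) ^ 2 * (σ 3 N : ℂ) * Complex.exp (2 * π * Complex.I * z) ^ (N : ℕ) =
      normalizedDerivOfComplex (normalizedDerivOfComplex (ModularForm.E₄ : ℍ → ℂ)) z / 240 := by
  have h := hasSum_normalizedDerivOfComplex (hasSum_normalizedDerivOfComplex hasSum_E₄) z
  rw [eq_div_iff (by norm_num), ← h.tsum_eq, ← tsum_zero_pnat_eq_tsum_nat h.summable,
    ← tsum_mul_right]
  simp
  exact tsum_congr fun N ↦ by ring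

lemma tsum_sigma_five {z : ℍ} (hz : ModularForm.E₆ z = 0) :
    ∑' N : ℕ+, (σ 5 N : ℂ) * Complex.exp (2 * π * Complex.I * z) ^ (N : ℕ) = 1 / 504 := by
  have h := hasSum_E₆ z
  have h2 := h.tsum_eq
  rw [← tsum_zero_pnat_eq_tsum_nat h.summable, hz] at h2
  simp [mul_assoc (504 : ℂ), tsum_mul_left, tsum_neg] at h2
  linear_combination -h2 / 504

/-- The series in terms of the value of `E₄` at `i`. -/
lemma tsum_eq_E₄_I :
    ((∑' n : ℕ, (-1 : ℝ) ^ (n+1) * ((n:ℝ)+1) ^ 5 / Real.sinh (((n:ℝ)+1) * π) ^ 3 : ℝ) : ℂ) =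
      ModularForm.E₄ UpperHalfPlane.I ^ 2 / 144 -
        5 * ModularForm.E₄ UpperHalfPlane.I / (48 * π ^ 2) := by
  set q : ℂ := Complex.exp (2 * π * Complex.I * halfOnePlusI) with hqdef
  have hq : q = -Complex.exp (-π) := by
    rw [hqdef, ← Complex.exp_add_pi_mul_I]
    congr 1
    simp only [halfOnePlusI]
    linear_combination π * Complex.I_sq
  have hq2 : q ^ 2 = Complex.exp (2 * π * Complex.I * UpperHalfPlane.I) := by
    rw [hq, neg_sq, ← Complex.exp_nat_mul, UpperHalfPlane.coe_I]
    congr 1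
    push_cast
    linear_combination -2 * π * Complex.I_sq
  have hq1 : ‖q‖ < 1 := by
    rw [hq, norm_neg, Complex.norm_exp]
    simpa using pi_pos
  have h := tsum_pow_five_mul_odd_part hq1
  rw [hq2, hqdef, tsum_sq_mul_sigma_three, tsum_sq_mul_sigma_three,
    tsum_sigma_five E₆_halfOnePlusI, tsum_sigma_five E₆_I,
    normalizedDerivOfComplex_normalizedDerivOfComplex_E₄ E₆_halfOnePlusI,
    normalizedDerivOfComplex_normalizedDerivOfComplex_E₄ E₆_I, E2_I, E2_halfOnePlusI,
    E₄_halfOnePlusI, ← hqdef] at h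
  have hpi : (π : ℂ) ≠ 0 := by exact_mod_cast pi_ne_zero
  trans ∑' n : ℕ+, (n : ℂ) ^ 5 * (8 * (q ^ (n : ℕ)) ^ 3 / (1 - (q ^ (n : ℕ)) ^ 2) ^ 3)
  · rw [tsum_pnat_eq_tsum_succ (f := fun n : ℕ ↦
      (n : ℂ) ^ 5 * (8 * (q ^ n) ^ 3 / (1 - (q ^ n) ^ 2) ^ 3)), Complex.ofReal_tsum]
    refine tsum_congr fun n ↦ ?_
    have hx : q ^ (n + 1) = (-1) ^ (n + 1) * Complex.exp (-((n + 1) * π)) := by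
      rw [hq, neg_pow, ← Complex.exp_nat_mul]
      congr 2
      push_cast
      ring
    have hs : ((-1 : ℂ) ^ (n + 1)) ^ 2 = 1 := by rw [← pow_mul, mul_comm, pow_mul]; simp
    rw [hx]
    push_cast
    rw [Complex.sinh]
    have hne : 1 - Complex.exp (-((n + 1) * π)) ^ 2 ≠ 0 := by
      refine sub_ne_zero.mpr fun h1 ↦ ?_
      have h2 : ‖Complex.exp (-((n + 1) * π))‖ < 1 := by
        rw [Complex.norm_exp]
        simp
        positivity
      have h3 := congrArg norm h1
      rw [norm_one, norm_pow] at h3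
      exact (pow_lt_one₀ (norm_nonneg _) h2 two_ne_zero).ne h3.symm
    rw [show Complex.exp ((n + 1) * π) = (Complex.exp (-((n + 1) * π)))⁻¹ by
      rw [Complex.exp_neg, inv_inv]]
    have he := Complex.exp_ne_zero (-((n + 1) * π))
    generalize Complex.exp (-((n + 1) * π)) = e at *
    rw [mul_pow, mul_pow, pow_succ ((-1 : ℂ) ^ (n + 1)), hs, one_mul, one_mul]
    generalize (-1 : ℂ) ^ (n + 1) = s at *
    field_simp
    norm_num
  · rw [h]
    field_simp
    ring

noncomputable def gaussianPeriodPair : PeriodPair where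
  ω₁ := 1
  ω₂ := Complex.I
  indep := by
    simpa only [Complex.coe_basisOneI] using Complex.basisOneI.linearIndependent

lemma mem_lattice_gaussianPeriodPair {z : ℂ} :
    z ∈ gaussianPeriodPair.lattice ↔ ∃ m n : ℤ, (m + n * Complex.I : ℂ) = z := by
  simp [mem_lattice, gaussianPeriodPair]

lemma ofReal_notMem_lattice_gaussianPeriodPair {x : ℝ} (h₀ : 0 < x) (h₁ : x < 1) :
    (x : ℂ) ∉ gaussianPeriodPair.lattice := by
  rw [mem_lattice_gaussianPeriodPair]
  rintro ⟨m, n, h⟩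
  have hx : (m : ℝ) = x := by simpa using congrArg Complex.re h
  have hm₀ : 0 < m := by exact_mod_cast hx ▸ h₀
  have hm₁ : m < 1 := by exact_mod_cast hx ▸ h₁
  omega

lemma tsum_lattice_gaussianPeriodPair (f : ℂ → ℂ) :
    ∑' l : gaussianPeriodPair.lattice, f l = ∑' v : ℤ × ℤ, f (v.1 + v.2 * Complex.I) := by
  rw [← gaussianPeriodPair.latticeEquivProd.symm.toEquiv.tsum_eq]
  refine tsum_congr fun v ↦ ?_
  have := gaussianPeriodPair.latticeEquiv_symm_apply v
  simp only [gaussianPeriodPair, mul_one] at this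
  exact congrArg f this

lemma g₃_gaussianPeriodPair : gaussianPeriodPair.g₃ = 0 := by
  have h : gaussianPeriodPair.G 6 = -gaussianPeriodPair.G 6 := by
    simp only [G]
    rw [tsum_lattice_gaussianPeriodPair fun z ↦ (z ^ 6)⁻¹, ← tsum_neg,
      ← ((Equiv.prodComm ℤ ℤ).trans (Equiv.prodCongr (Equiv.neg ℤ) (Equiv.refl ℤ))).tsum_eq]
    refine tsum_congr fun v ↦ ?_
    rw [← inv_neg]
    congr 1
    simp only [Equiv.trans_apply, Equiv.prodComm_apply, Equiv.prodCongr_apply, Prod.map,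
      Equiv.neg_apply, Equiv.refl_apply, Prod.fst_swap, Prod.snd_swap, Int.cast_neg]
    have : (-v.2 + v.1 * Complex.I : ℂ) = Complex.I * (v.1 + v.2 * Complex.I) := by
      linear_combination (-v.2 : ℂ) * Complex.I_mul_I
    rw [this, mul_pow, show (6 : ℕ) = 4 + 2 from rfl, pow_add Complex.I, Complex.I_pow_four,
      Complex.I_sq]
    ring
  rw [g₃, self_eq_neg.mp h, mul_zero]

lemma g₂_gaussianPeriodPair :
    gaussianPeriodPair.g₂ = 4 * π ^ 4 / 3 * ModularForm.E₄ UpperHalfPlane.I := by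
  have h : gaussianPeriodPair.G 4 =
      ∑' v : Fin 2 → ℤ, EisensteinSeries.eisSummand (4 : ℕ) v UpperHalfPlane.I := by
    rw [G, tsum_lattice_gaussianPeriodPair fun z ↦ (z ^ 4)⁻¹,
      ← ((finTwoArrowEquiv ℤ).trans (Equiv.prodComm ℤ ℤ)).tsum_eq]
    refine tsum_congr fun v ↦ ?_
    simp only [EisensteinSeries.eisSummand, Equiv.trans_apply, finTwoArrowEquiv_apply,
      Equiv.prodComm_apply, Prod.fst_swap, Prod.snd_swap, zpow_neg, zpow_natCast,
      UpperHalfPlane.coe_I]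
    rw [add_comm]
    rfl
  have hE : eisensteinSeries (N := 1) 0 (4 : ℕ) UpperHalfPlane.I =
      2 * ModularForm.E₄ UpperHalfPlane.I := by
    rw [show ModularForm.E₄ UpperHalfPlane.I = (1 / 2 : ℂ) •
      EisensteinSeries.eisensteinSeriesSIF (N := 1) 0 4 UpperHalfPlane.I from rfl,
      EisensteinSeries.eisensteinSeriesSIF_apply]
    simp
  rw [g₂, h, tsum_eisSummand_eq_riemannZeta_mul_eisensteinSeries (by norm_num), hE,
    Nat.cast_ofNat, riemannZeta_four]
  ring

lemma weierstrassP_conj (z : ℂ) : gaussianPeriodPair.weierstrassP (starRingEnd ℂ z) =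
    starRingEnd ℂ (gaussianPeriodPair.weierstrassP z) := by
  simp only [weierstrassP]
  rw [Complex.conj_tsum, tsum_lattice_gaussianPeriodPair fun l ↦ 1 / (_ - l) ^ 2 - 1 / l ^ 2,
    tsum_lattice_gaussianPeriodPair fun l ↦ starRingEnd ℂ (1 / (_ - l) ^ 2 - 1 / l ^ 2),
    ← (Equiv.prodCongr (Equiv.refl ℤ) (Equiv.neg ℤ)).tsum_eq]
  refine tsum_congr fun v ↦ ?_
  simp

lemma derivWeierstrassP_conj (z : ℂ) : gaussianPeriodPair.derivWeierstrassP (starRingEnd ℂ z) =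
    starRingEnd ℂ (gaussianPeriodPair.derivWeierstrassP z) := by
  simp only [derivWeierstrassP]
  rw [map_neg, Complex.conj_tsum, tsum_lattice_gaussianPeriodPair fun l ↦ 2 / (_ - l) ^ 3,
    tsum_lattice_gaussianPeriodPair fun l ↦ starRingEnd ℂ (2 / (_ - l) ^ 3),
    ← (Equiv.prodCongr (Equiv.refl ℤ) (Equiv.neg ℤ)).tsum_eq]
  congr 1
  refine tsum_congr fun v ↦ ?_
  simp [map_ofNat]

lemma PeriodPair.tendsto_re_weierstrassP_atTop (L : PeriodPair) :
    Tendsto (fun x : ℝ ↦ (L.weierstrassP x).re) (𝓝[>] 0) atTop := by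
  have hc : Tendsto (fun x : ℝ ↦ (L.weierstrassPExcept 0 x).re) (𝓝[>] 0)
      (𝓝 (L.weierstrassPExcept 0 0).re) := by
    have h := ((L.analyticAt_weierstrassPExcept 0).continuousAt.tendsto.comp
      (Complex.continuous_ofReal.tendsto' 0 0 (by simp)))
    exact ((Complex.continuous_re.tendsto _).comp h).mono_left nhdsWithin_le_nhds
  have hi : Tendsto (fun x : ℝ ↦ (x ^ 2)⁻¹) (𝓝[>] 0) atTop := by
    simpa only [inv_pow, Function.comp_def] using
      (tendsto_pow_atTop two_ne_zero).comp (tendsto_inv_nhdsGT_zero (𝕜 := ℝ))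
  refine (hc.add_atTop hi).congr fun x ↦ ?_
  have h := L.weierstrassPExcept_add 0 (x : ℂ)
  simp only [Submodule.coe_zero, sub_zero] at h
  rw [← h, Complex.add_re]
  congr 1
  simp [← Complex.ofReal_pow, ← Complex.ofReal_inv]

lemma PeriodPair.isPreconnected_compl_lattice (L : PeriodPair) :
    IsPreconnected (L.lattice : Set ℂ)ᶜ :=
  have hc : (L.lattice : Set ℂ).Countable :=
    Set.countable_coe_iff.mp L.latticeEquivProd.injective.countable
  (hc.isConnected_compl_of_one_lt_rank (by simp)).isPreconnected

lemma PeriodPair.hasDerivAt_derivWeierstrassP (L : PeriodPair) {z : ℂ} (hz : z ∉ L.lattice) :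
    HasDerivAt L.derivWeierstrassP (6 * L.weierstrassP z ^ 2 - L.g₂ / 2) z := by
  have hU : IsOpen (L.lattice : Set ℂ)ᶜ := L.isClosed_lattice.isOpen_compl
  have hP : ∀ w ∉ L.lattice, HasDerivAt L.weierstrassP (L.derivWeierstrassP w) w := fun w hw ↦ by
    simpa using (L.analyticOnNhd_weierstrassP w hw).differentiableAt.hasDerivAt
  have hP' : ∀ w ∉ L.lattice,
      HasDerivAt L.derivWeierstrassP (deriv L.derivWeierstrassP w) w := fun w hw ↦
    (L.analyticOnNhd_derivWeierstrassP w hw).differentiableAt.hasDerivAt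
  have hmul : ∀ w ∈ (L.lattice : Set ℂ)ᶜ, L.derivWeierstrassP w *
      (deriv L.derivWeierstrassP w - (6 * L.weierstrassP w ^ 2 - L.g₂ / 2)) = 0 := fun w hw ↦ by
    have h₁ := (hP' w hw).pow 2
    have h₂ := ((((hP w hw).pow 3).const_mul 4).sub ((hP w hw).const_mul L.g₂)).sub_const L.g₃
    have h := h₁.unique (h₂.congr_of_eventuallyEq
      (Filter.eventually_of_mem (hU.mem_nhds hw) fun y hy ↦ L.derivWeierstrassP_sq y hy))
    simp only [Nat.cast_ofNat, Nat.add_one_sub_one, pow_one] at h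
    linear_combination h / 2
  have hD := L.analyticOnNhd_derivWeierstrassP
  have hF : AnalyticOnNhd ℂ (fun w ↦ deriv L.derivWeierstrassP w -
      (6 * L.weierstrassP w ^ 2 - L.g₂ / 2)) (L.lattice : Set ℂ)ᶜ :=
    hD.deriv.sub ((analyticOnNhd_const.mul (L.analyticOnNhd_weierstrassP.pow 2)).sub
      analyticOnNhd_const)
  rcases AnalyticOnNhd.eq_zero_or_eq_zero_of_mul_eq_zero hD hF hmul L.isPreconnected_compl_lattice
    with h | h
  · have hmem : ∀ᶠ x : ℝ in 𝓝[>] 0, (x : ℂ) ∈ (L.lattice : Set ℂ)ᶜ := by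
      have h₀ : Tendsto (fun x : ℝ ↦ (x : ℂ)) (𝓝[>] 0) (𝓝 0) :=
        (Complex.continuous_ofReal.tendsto' 0 0 (by simp)).mono_left nhdsWithin_le_nhds
      filter_upwards [h₀ (L.compl_lattice_sdiff_singleton_mem_nhds 0), self_mem_nhdsWithin]
        with x hx hx₀ hxL
      exact hx ⟨hxL, by simpa using (Set.mem_Ioi.mp hx₀).ne'⟩
    have hconst : ∀ᶠ x : ℝ in 𝓝[>] 0,
        (L.weierstrassP x).re = (L.weierstrassP z).re := hmem.mono fun x hx ↦ by
      rw [hU.is_const_of_deriv_eq_zero L.isPreconnected_compl_lattice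
        L.differentiableOn_weierstrassP (fun w hw ↦ by simpa using h w hw) hx hz]
    exact (not_tendsto_const_atTop _ _ (L.tendsto_re_weierstrassP_atTop.congr' hconst)).elim
  · rw [← sub_eq_zero.mp (h z hz)]
    exact hP' z hz

lemma beta_quarter_half :
    ∫ t in Ioo (0 : ℝ) 1, t ^ (-(3 / 4) : ℝ) * (1 - t) ^ (-(1 / 2) : ℝ) =
      Real.Gamma (1 / 4) ^ 2 / √(2 * π) := by
  have hB : ((∫ t in Ioo (0 : ℝ) 1, t ^ (-(3 / 4) : ℝ) * (1 - t) ^ (-(1 / 2) : ℝ) : ℝ) : ℂ) =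
      Complex.betaIntegral ((1 / 4 : ℝ) : ℂ) ((1 / 2 : ℝ) : ℂ) := by
    rw [Complex.betaIntegral, intervalIntegral.integral_of_le zero_le_one,
      integral_Ioc_eq_integral_Ioo, ← integral_complex_ofReal]
    refine setIntegral_congr_fun measurableSet_Ioo fun t ht ↦ ?_
    simp only [Complex.ofReal_mul, Complex.ofReal_cpow ht.1.le,
      Complex.ofReal_cpow (sub_nonneg.mpr ht.2.le), Complex.ofReal_sub, Complex.ofReal_one]
    congr 2 <;> push_cast <;> ring
  have hG := Complex.Gamma_mul_Gamma_eq_betaIntegral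
    (s := ((1 / 4 : ℝ) : ℂ)) (t := ((1 / 2 : ℝ) : ℂ)) (by norm_num) (by norm_num)
  rw [← hB, ← Complex.ofReal_add, Complex.Gamma_ofReal, Complex.Gamma_ofReal,
    Complex.Gamma_ofReal] at hG
  norm_cast at hG
  rw [Real.Gamma_one_half_eq, show (1 / 4 + 1 / 2 : ℝ) = 1 - 1 / 4 by norm_num] at hG
  have hR := Real.Gamma_mul_Gamma_one_sub (1 / 4)
  rw [show π * (1 / 4) = π / 4 by ring, Real.sin_pi_div_four] at hR
  have h₁ : 0 < Real.Gamma (1 - 1 / 4) := Real.Gamma_pos_of_pos (by norm_num)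
  have hs : √(2 * π) = √2 * √π := Real.sqrt_mul (by norm_num) π
  have h2 : √2 ^ 2 = 2 := Real.sq_sqrt (by norm_num)
  have hp : √π ^ 2 = π := Real.sq_sqrt pi_pos.le
  have h2' : 0 < √2 := by positivity
  have hp' : 0 < √π := by positivity
  have hR' : Real.Gamma (1 / 4) * Real.Gamma (1 - 1 / 4) = √2 * √π ^ 2 := by
    rw [hR, hp]; field_simp; rw [h2]
  rw [hs, eq_div_iff (by positivity)]
  refine mul_left_cancel₀ h₁.ne' ?_
  linear_combination -√2 * √π * hG - Real.Gamma (1 / 4) * hR'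

/-- A real solution of `p' ^ 2 = 4 p (p ^ 2 - e ^ 2)` on `(0, 1)` with a pole at `0` and a critical
point at `1 / 2` has a half period given by a complete elliptic integral. -/
lemma two_mul_sqrt_eq_integral {p p' : ℝ → ℝ} {e : ℝ} (he : 0 < e)
    (hp : ∀ x ∈ Ioo (0 : ℝ) 1, HasDerivAt p (p' x) x)
    (hp' : ∀ x ∈ Ioo (0 : ℝ) 1, HasDerivAt p' (6 * p x ^ 2 - 2 * e ^ 2) x)
    (hode : ∀ x ∈ Ioo (0 : ℝ) 1, p' x ^ 2 = 4 * p x * (p x ^ 2 - e ^ 2))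
    (htop : Tendsto p (𝓝[>] 0) atTop) (hhalf : p' (1 / 2) = 0) :
    2 * √e = ∫ t in Ioo (0 : ℝ) 1, t ^ (-(3 / 4) : ℝ) * (1 - t) ^ (-(1 / 2) : ℝ) := by
  have hlarge : ∀ x > 0, ∀ b, ∃ y ∈ Ioo 0 x, b < p y := fun x hx b ↦ by
    obtain ⟨y, hy, hy'⟩ := ((htop.eventually_gt_atTop b).and (Ioo_mem_nhdsGT hx)).exists
    exact ⟨y, hy', hy⟩
  have hcont : ContinuousOn p (Ioo 0 1) := fun x hx ↦ (hp x hx).continuousAt.continuousWithinAt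
  have hge : ∀ x ∈ Ioo (0 : ℝ) 1, e ≤ p x := fun x hx ↦ by
    by_contra! hlt
    have hsq := hode x hx
    have hle : p x ≤ 0 := by
      by_contra! hpos
      nlinarith [sq_nonneg (p' x), mul_pos hpos (mul_pos (sub_pos.mpr hlt) (add_pos hpos he))]
    obtain ⟨y, hy, hey⟩ := hlarge x hx.1 e
    obtain ⟨z, hz, hz'⟩ := intermediate_value_Icc' hy.2.le
      (hcont.mono fun t ht ↦ ⟨hy.1.trans_le ht.1, ht.2.trans_lt hx.2⟩)
      (show e / 2 ∈ Icc (p x) (p y) from ⟨by linarith, by linarith⟩)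
    have := hode z ⟨hy.1.trans_le hz.1, hz.2.trans_lt hx.2⟩
    rw [hz'] at this
    nlinarith [sq_nonneg (p' z), pow_pos he 3]
  have hmono : StrictMonoOn p' (Ioo 0 1) := by
    refine strictMonoOn_of_deriv_pos (convex_Ioo 0 1)
      (fun x hx ↦ (hp' x hx).continuousAt.continuousWithinAt) fun x hx ↦ ?_
    rw [interior_Ioo] at hx
    rw [(hp' x hx).deriv]
    nlinarith [hge x hx]
  have hsub : Ioo (0 : ℝ) (1 / 2) ⊆ Ioo 0 1 := Ioo_subset_Ioo_right (by norm_num)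
  have hhalf_mem : (1 / 2 : ℝ) ∈ Ioo (0 : ℝ) 1 := by norm_num
  have hneg : ∀ x ∈ Ioo (0 : ℝ) (1 / 2), p' x < 0 := fun x hx ↦
    hhalf ▸ hmono (hsub hx) hhalf_mem hx.2
  have hgt : ∀ x ∈ Ioo (0 : ℝ) (1 / 2), e < p x := fun x hx ↦ by
    refine (hge x (hsub hx)).lt_of_ne fun h ↦ (hneg x hx).ne ?_
    simpa [← h] using hode x (hsub hx)
  have hpe : p (1 / 2) = e := by
    have h := hode _ hhalf_mem
    have hge' := hge _ hhalf_mem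
    rw [hhalf] at h
    by_contra hne
    have hlt := lt_of_le_of_ne hge' (Ne.symm hne)
    nlinarith [mul_pos (he.trans hlt) (mul_pos (sub_pos.mpr hlt) (add_pos (he.trans hlt) he))]
  have hanti : StrictAntiOn p (Ioo 0 (1 / 2)) := by
    refine strictAntiOn_of_deriv_neg (convex_Ioo 0 _) (hcont.mono hsub) fun x hx ↦ ?_
    rw [interior_Ioo] at hx
    rw [(hp x (hsub hx)).deriv]
    exact hneg x hx
  set w : ℝ → ℝ := fun x ↦ (e / p x) ^ 2 with hw
  have hwd : ∀ x ∈ Ioo (0 : ℝ) (1 / 2),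
      HasDerivWithinAt w (-(2 * e ^ 2 * p' x / p x ^ 3)) (Ioo 0 (1 / 2)) x := fun x hx ↦ by
    have hpx : p x ≠ 0 := (he.trans (hgt x hx)).ne'
    refine ((((hp x (hsub hx)).inv hpx).const_mul e).pow 2).hasDerivWithinAt.congr_deriv ?_ |>.congr
      (fun y _ ↦ ?_) ?_
    · simp; field_simp
    · simp [hw, div_eq_mul_inv]
    · simp [hw, div_eq_mul_inv]
  have hinj : InjOn w (Ioo 0 (1 / 2)) := fun x hx y hy hxy ↦ by
    have hx₀ := he.trans (hgt x hx)
    have hy₀ := he.trans (hgt y hy)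
    have h := (pow_left_inj₀ (by positivity) (by positivity) two_ne_zero).mp hxy
    refine hanti.injOn hx hy ?_
    rw [div_eq_div_iff hx₀.ne' hy₀.ne'] at h
    exact (mul_left_cancel₀ he.ne' h).symm
  have himage : w '' Ioo 0 (1 / 2) = Ioo 0 1 := by
    refine Subset.antisymm ?_ fun t ht ↦ ?_
    · rintro _ ⟨x, hx, rfl⟩
      have hx₀ := he.trans (hgt x hx)
      exact ⟨by positivity, pow_lt_one₀ (by positivity) ((div_lt_one hx₀).mpr (hgt x hx))
        two_ne_zero⟩
    · have hst : 0 < √t := sqrt_pos.mpr ht.1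
      have hst' : √t < 1 := by rw [sqrt_lt' one_pos]; simpa using ht.2
      obtain ⟨y, hy, hey⟩ := hlarge (1 / 2) (by norm_num) (e / √t)
      have hlt : e < e / √t := by rw [lt_div_iff₀ hst]; nlinarith
      obtain ⟨x, hx, hx'⟩ := intermediate_value_Ioo' hy.2.le
        (hcont.mono fun t ht ↦ ⟨hy.1.trans_le ht.1, ht.2.trans_lt (by norm_num)⟩)
        (show e / √t ∈ Ioo (p (1 / 2)) (p y) from ⟨hpe.symm ▸ hlt, hey⟩)
      refine ⟨x, ⟨hy.1.trans hx.1, hx.2⟩, ?_⟩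
      simp only [hw, hx', div_div_cancel₀ he.ne', sq_sqrt ht.1.le]
  have h := integral_image_eq_integral_abs_deriv_smul measurableSet_Ioo hwd hinj
    fun t ↦ t ^ (-(3 / 4) : ℝ) * (1 - t) ^ (-(1 / 2) : ℝ)
  rw [← himage, h]
  have hconst : ∀ x ∈ Ioo (0 : ℝ) (1 / 2), |-(2 * e ^ 2 * p' x / p x ^ 3)| •
      (w x ^ (-(3 / 4) : ℝ) * (1 - w x) ^ (-(1 / 2) : ℝ)) = 4 * √e := fun x hx ↦ by
    have hq : 0 < p x := he.trans (hgt x hx)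
    have hu : 0 < e / p x := div_pos he hq
    have hw1 : 0 < 1 - w x := by
      have : w x ∈ Ioo (0 : ℝ) 1 := himage ▸ mem_image_of_mem w hx
      exact sub_pos.mpr this.2
    have hsw : 0 < √(1 - w x) := sqrt_pos.mpr hw1
    have hsq : 0 < √(p x) := sqrt_pos.mpr hq
    have hse : 0 < √e := sqrt_pos.mpr he
    have habs : |p' x| = 2 * (p x * √(p x) * √(1 - w x)) := by
      rw [← abs_of_pos (show 0 < 2 * (p x * √(p x) * √(1 - w x)) by positivity),
        ← sq_eq_sq_iff_abs_eq_abs, hode x (hsub hx), mul_pow, mul_pow, mul_pow, sq_sqrt hq.le,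
        sq_sqrt hw1.le]
      simp only [hw]
      field_simp
      ring
    have hpow₁ : w x ^ (-(3 / 4) : ℝ) = (e / p x * (√e / √(p x)))⁻¹ := by
      rw [← sqrt_div he.le, sqrt_eq_rpow, rpow_neg (sq_nonneg _)]
      congr 1
      rw [← rpow_natCast, ← rpow_mul hu.le]
      nth_rw 2 [← rpow_one (e / p x)]
      rw [← rpow_add hu]
      norm_num
    have hpow₂ : (1 - w x) ^ (-(1 / 2) : ℝ) = (√(1 - w x))⁻¹ := by
      rw [rpow_neg hw1.le, sqrt_eq_rpow]
    rw [hpow₁, hpow₂, abs_neg, abs_div, abs_mul, habs, abs_of_pos (by positivity : 0 < 2 * e ^ 2),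
      abs_of_pos (pow_pos hq 3), smul_eq_mul]
    field_simp
    rw [sq_sqrt he.le, sq_sqrt hq.le]
    ring
  rw [setIntegral_congr_fun measurableSet_Ioo hconst]
  simp
  ring

lemma exists_pos_E₄_I_eq : ∃ r : ℝ, 0 < r ∧ ModularForm.E₄ UpperHalfPlane.I = r := by
  have hS := hasSum_E₄ UpperHalfPlane.I
  have ha : ∀ m : ℕ, (if m = 0 then 1 else 240 * (σ 3 m : ℂ)) *
      Complex.exp (2 * π * Complex.I * UpperHalfPlane.I) ^ m =
      (((if m = 0 then 1 else 240 * (σ 3 m : ℝ)) * Real.exp (-2 * π) ^ m : ℝ) : ℂ) := fun m ↦ by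
    rw [UpperHalfPlane.coe_I, mul_assoc (2 * π : ℂ), Complex.I_mul_I]
    split_ifs <;> push_cast <;> ring_nf
  simp_rw [ha] at hS
  have hre := Complex.hasSum_re hS
  have him := Complex.hasSum_im hS
  simp only [Complex.ofReal_re, Complex.ofReal_im] at hre him
  refine ⟨(ModularForm.E₄ UpperHalfPlane.I).re, ?_, Complex.ext rfl ?_⟩
  · refine one_pos.trans_le ?_
    simpa using le_hasSum hre 0 fun m _ ↦ by positivity
  · simpa using him.unique hasSum_zero

lemma E₄_I : ModularForm.E₄ UpperHalfPlane.I =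
    ((3 * Real.Gamma (1 / 4) ^ 8 / (64 * π ^ 6) : ℝ) : ℂ) := by
  obtain ⟨r, hr, hE⟩ := exists_pos_E₄_I_eq
  set L := gaussianPeriodPair
  set e : ℝ := √(π ^ 4 * r / 3) with he_def
  have hg : L.g₂ = ((4 * e ^ 2 : ℝ) : ℂ) := by
    rw [g₂_gaussianPeriodPair, hE, he_def, sq_sqrt (by positivity)]
    push_cast
    ring
  have he : 0 < e := sqrt_pos.mpr (by positivity)
  have hP : ∀ x : ℝ, ((L.weierstrassP x).re : ℂ) = L.weierstrassP x := fun x ↦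
    Complex.conj_eq_iff_re.mp (by rw [← weierstrassP_conj, Complex.conj_ofReal])
  have hP' : ∀ x : ℝ, ((L.derivWeierstrassP x).re : ℂ) = L.derivWeierstrassP x := fun x ↦
    Complex.conj_eq_iff_re.mp (by rw [← derivWeierstrassP_conj, Complex.conj_ofReal])
  have hmem : ∀ x ∈ Ioo (0 : ℝ) 1, (x : ℂ) ∉ L.lattice := fun x hx ↦
    ofReal_notMem_lattice_gaussianPeriodPair hx.1 hx.2
  have hint := two_mul_sqrt_eq_integral (p := fun x ↦ (L.weierstrassP x).re)
    (p' := fun x ↦ (L.derivWeierstrassP x).re) he ?_ ?_ ?_ L.tendsto_re_weierstrassP_atTop ?_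
  · rw [beta_quarter_half] at hint
    have h₁ : (2 * √e) ^ 4 = (Real.Gamma (1 / 4) ^ 2 / √(2 * π)) ^ 4 := by rw [hint]
    have h₂ : e ^ 2 = π ^ 4 * r / 3 := sq_sqrt (by positivity)
    have h₃ : √e ^ 4 = e ^ 2 := by rw [show 4 = 2 * 2 from rfl, pow_mul, sq_sqrt he.le]
    have h₄ : √(2 * π) ^ 4 = (2 * π) ^ 2 := by
      rw [show 4 = 2 * 2 from rfl, pow_mul, sq_sqrt (by positivity)]
    rw [mul_pow, div_pow, h₃, h₂, h₄] at h₁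
    rw [hE]
    congr 1
    field_simp at h₁ ⊢
    linear_combination h₁
  · intro x hx
    have h := (L.analyticOnNhd_weierstrassP x (hmem x hx)).differentiableAt.hasDerivAt
    rw [deriv_weierstrassP] at h
    exact h.real_of_complex
  · intro x hx
    convert (L.hasDerivAt_derivWeierstrassP (hmem x hx)).real_of_complex using 1
    rw [hg, ← hP x]
    norm_cast
    ring
  · intro x hx
    have h := L.derivWeierstrassP_sq x (hmem x hx)
    rw [g₃_gaussianPeriodPair, hg, ← hP x, ← hP' x] at h
    norm_cast at h
    linear_combination h
  · have h₁ : (1 : ℂ) ∈ L.lattice := L.ω₁_mem_lattice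
    have h := L.derivWeierstrassP_add_coe (-(1 / 2)) ⟨1, h₁⟩
    rw [show (-(1 / 2) + ((⟨1, h₁⟩ : L.lattice) : ℂ)) = 1 / 2 by norm_num, derivWeierstrassP_neg,
      self_eq_neg] at h
    rw [show ((1 / 2 : ℝ) : ℂ) = 1 / 2 by norm_num, h, Complex.zero_re]

end

theorem sum_n5_sinh_cubed :
    (∑' n : ℕ, (-1 : ℝ) ^ (n+1) * ((n:ℝ)+1) ^ 5 / Real.sinh (((n:ℝ)+1) * π) ^ 3) =
      -(5 * Real.Gamma (1/4) ^ 8 / (2 ^ 10 * π ^ 8))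
    + Real.Gamma (1/4) ^ 16 / (2 ^ 16 * π ^ 12) := by
  have h := tsum_eq_E₄_I
  rw [E₄_I] at h
  refine Complex.ofReal_injective (h.trans ?_)
  push_cast
  have hpi : (π : ℂ) ≠ 0 := Complex.ofReal_ne_zero.mpr pi_ne_zero
  field_simp
  ring
end

section
/- Σ_{n=1}^∞ (−1)^n n^6 · cosh(nπ) / sinh(nπ)^4 = 3Γ^16/(2^16 π^13) − Γ^16/(3·2^15 π^12) − 5Γ^8/(2^10 π^9), where Γ = Γ(1/4). -/
open Real

namespace SechSeries

/-- `g` is `O(exp (-|x|))` away from every neighbourhood of `0`. -/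
def ExpDecay (g : ℝ → ℝ) : Prop :=
  ∀ δ > 0, ∃ M, ∀ x : ℝ, δ ≤ |x| → |g x| ≤ M * exp (-|x|)

/-- `g` is bounded away from every neighbourhood of `0`. -/
def BddAway (g : ℝ → ℝ) : Prop :=
  ∀ δ > 0, ∃ M, ∀ x : ℝ, δ ≤ |x| → |g x| ≤ M

lemma ExpDecay.bddAway {g : ℝ → ℝ} (hg : ExpDecay g) : BddAway g := by
  intro δ hδ
  obtain ⟨M, hM⟩ := hg δ hδ
  refine ⟨M, fun x hx => (hM x hx).trans ?_⟩
  have h0 : 0 ≤ M := by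
    by_contra! h
    have := (abs_nonneg _).trans (hM x hx)
    nlinarith [exp_pos (-|x|)]
  have : exp (-|x|) ≤ 1 := exp_le_one_iff.mpr (by simp)
  nlinarith

lemma ExpDecay.mul_bdd {f g : ℝ → ℝ} (hf : ExpDecay f) (hg : BddAway g) :
    ExpDecay (fun x => f x * g x) := by
  intro δ hδ
  obtain ⟨M, hM⟩ := hf δ hδ
  obtain ⟨K, hK⟩ := hg δ hδ
  refine ⟨M * K, fun x hx => ?_⟩
  rw [abs_mul]
  calc |f x| * |g x| ≤ (M * exp (-|x|)) * K :=
        mul_le_mul (hM x hx) (hK x hx) (abs_nonneg _) ((abs_nonneg _).trans (hM x hx))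
    _ = _ := by ring

lemma ExpDecay.const_mul {f : ℝ → ℝ} (hf : ExpDecay f) (c : ℝ) :
    ExpDecay (fun x => c * f x) := by
  have : BddAway (fun _ => c) := fun _ _ => ⟨|c|, fun _ _ => le_rfl⟩
  simpa only [mul_comm] using hf.mul_bdd this

lemma ExpDecay.add {f g : ℝ → ℝ} (hf : ExpDecay f) (hg : ExpDecay g) :
    ExpDecay (fun x => f x + g x) := by
  intro δ hδ
  obtain ⟨M, hM⟩ := hf δ hδ
  obtain ⟨K, hK⟩ := hg δ hδ
  refine ⟨M + K, fun x hx => (abs_add_le _ _).trans ?_⟩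
  rw [add_mul]
  exact add_le_add (hM x hx) (hK x hx)

lemma expDecay_inv_cosh : ExpDecay (fun x => (cosh x)⁻¹) := by
  intro δ _
  refine ⟨2, fun x _ => ?_⟩
  rw [abs_inv, abs_of_pos (cosh_pos x), ← cosh_abs, cosh_eq, exp_neg]
  have h1 := exp_pos |x|
  rw [inv_le_comm₀ (by positivity) (by positivity)]
  rw [mul_inv, inv_inv]
  have := inv_pos.mpr h1
  linarith

lemma expDecay_inv_sinh : ExpDecay (fun x => (sinh x)⁻¹) := by
  intro δ hδ
  refine ⟨2 / (1 - exp (-(2 * δ))), fun x hx => ?_⟩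
  have hc : 0 < 1 - exp (-(2 * δ)) := by
    have : exp (-(2 * δ)) < 1 := by
      rw [exp_lt_one_iff]; linarith
    linarith
  have h1 := exp_pos |x|
  rw [abs_inv, abs_sinh, exp_neg |x|, ← div_eq_mul_inv, div_div, ← one_div]
  rw [div_le_div_iff₀ (sinh_pos_iff.mpr (hδ.trans_le hx)) (by positivity)]
  rw [sinh_eq]
  have h2 : exp (-|x|) = exp |x| * exp (-(2 * |x|)) := by rw [← exp_add]; ring_nf
  have h3 : exp (-(2 * |x|)) ≤ exp (-(2 * δ)) := exp_le_exp.mpr (by linarith)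
  rw [h2]
  nlinarith

lemma bddAway_tanh : BddAway tanh := fun _ _ => ⟨1, fun x _ => (abs_tanh_lt_one x).le⟩

lemma bddAway_coth : BddAway (fun x => cosh x / sinh x) := by
  intro δ hδ
  obtain ⟨M, hM⟩ := expDecay_inv_sinh δ hδ
  refine ⟨M, fun x hx => ?_⟩
  rw [abs_div, div_eq_mul_inv, ← abs_inv, abs_of_pos (cosh_pos x)]
  have hc : cosh x ≤ exp |x| := by
    rw [← cosh_abs, cosh_eq]
    have : exp (-|x|) ≤ exp |x| := exp_le_exp.mpr (by linarith [abs_nonneg x])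
    linarith
  calc cosh x * |(sinh x)⁻¹| ≤ exp |x| * (M * exp (-|x|)) :=
        mul_le_mul hc (hM x hx) (abs_nonneg _) (exp_pos _).le
    _ = M := by rw [mul_left_comm, ← exp_add]; simp

lemma summable_abs_int_pow_mul_exp (k : ℕ) {r : ℝ} (hr : 0 < r) :
    Summable (fun n : ℤ => |(n : ℝ)| ^ k * exp (-(|(n : ℝ)| * r))) := by
  have h := summable_pow_mul_exp_neg_nat_mul k hr
  refine Summable.of_nat_of_neg ?_ ?_ <;>
  · refine h.congr fun n => ?_
    simp [mul_comm]

lemma ExpDecay.summable {g : ℝ → ℝ} (hg : ExpDecay g) (k : ℕ) {α : ℝ} (hα : 0 < α) :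
    Summable (fun n : ℤ => (n : ℝ) ^ k * g (n * α)) := by
  obtain ⟨M, hM⟩ := hg α hα
  refine Summable.of_norm_bounded_eventually
    (g := fun n : ℤ => M * (|(n : ℝ)| ^ k * exp (-(|(n : ℝ)| * α))))
    ((summable_abs_int_pow_mul_exp k hα).mul_left M) ?_
  refine (Set.finite_singleton (0 : ℤ)).subset fun n hn => ?_
  by_contra h0
  apply hn
  have h1 : (1 : ℝ) ≤ |(n : ℝ)| := by
    rw [← Int.cast_abs]; exact_mod_cast Int.one_le_abs h0
  have := hM (n * α) (by rw [abs_mul, abs_of_pos hα]; nlinarith)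
  rw [abs_mul, abs_of_pos hα] at this
  change ‖(n : ℝ) ^ k * g (n * α)‖ ≤ _
  rw [norm_mul, norm_pow, norm_eq_abs, norm_eq_abs]
  calc _ ≤ |(n : ℝ)| ^ k * (M * exp (-(|(n : ℝ)| * α))) := by gcongr
    _ = _ := by ring

/-- The cosine series with coefficients `n ^ k * g (n α)`, summed over all integers. -/
noncomputable def cosSeries (g : ℝ → ℝ) (k : ℕ) (α t : ℝ) : ℝ :=
  ∑' n : ℤ, (n : ℝ) ^ k * g (n * α) * cos (n * t)

/-- The sine series with coefficients `n ^ k * g (n α)`, summed over all integers. -/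
noncomputable def sinSeries (g : ℝ → ℝ) (k : ℕ) (α t : ℝ) : ℝ :=
  ∑' n : ℤ, (n : ℝ) ^ k * g (n * α) * sin (n * t)

lemma summable_mul_cos {A : ℤ → ℝ} (hA : Summable A) (t : ℝ) :
    Summable (fun n : ℤ => A n * cos (n * t)) :=
  Summable.of_norm_bounded hA.abs fun n => by
    rw [norm_mul]; exact mul_le_of_le_one_right (abs_nonneg _) (abs_cos_le_one _)

lemma summable_mul_sin {A : ℤ → ℝ} (hA : Summable A) (t : ℝ) :
    Summable (fun n : ℤ => A n * sin (n * t)) :=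
  Summable.of_norm_bounded hA.abs fun n => by
    rw [norm_mul]; exact mul_le_of_le_one_right (abs_nonneg _) (abs_sin_le_one _)

lemma hasDerivAt_cosSeries {g : ℝ → ℝ} (hg : ExpDecay g) (k : ℕ) {α : ℝ} (hα : 0 < α) (t : ℝ) :
    HasDerivAt (cosSeries g k α) (-sinSeries g (k + 1) α t) t := by
  have h : -sinSeries g (k + 1) α t =
      ∑' n : ℤ, -((n : ℝ) ^ (k + 1) * g (n * α) * sin (n * t)) := tsum_neg.symm
  rw [h]
  refine hasDerivAt_tsum (𝕜 := ℝ) (g := fun (n : ℤ) y => (n : ℝ) ^ k * g (n * α) * cos (n * y))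
    (g' := fun (n : ℤ) y => -((n : ℝ) ^ (k + 1) * g (n * α) * sin (n * y)))
    (hg.summable (k + 1) hα).abs (fun n y => ?_) (fun n y => ?_)
    (y₀ := 0) (summable_mul_cos (hg.summable k hα) 0) t
  · have := (((hasDerivAt_id y).const_mul (n : ℝ)).cos).const_mul ((n : ℝ) ^ k * g (n * α))
    exact this.congr_deriv (by simp only [id]; ring)
  · rw [norm_neg, norm_mul]
    exact mul_le_of_le_one_right (abs_nonneg _) (abs_sin_le_one _)

lemma hasDerivAt_sinSeries {g : ℝ → ℝ} (hg : ExpDecay g) (k : ℕ) {α : ℝ} (hα : 0 < α) (t : ℝ) :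
    HasDerivAt (sinSeries g k α) (cosSeries g (k + 1) α t) t := by
  refine hasDerivAt_tsum (𝕜 := ℝ) (g := fun (n : ℤ) y => (n : ℝ) ^ k * g (n * α) * sin (n * y))
    (g' := fun (n : ℤ) y => (n : ℝ) ^ (k + 1) * g (n * α) * cos (n * y))
    (hg.summable (k + 1) hα).abs (fun n y => ?_) (fun n y => ?_)
    (y₀ := 0) (summable_mul_sin (hg.summable k hα) 0) t
  · have := (((hasDerivAt_id y).const_mul (n : ℝ)).sin).const_mul ((n : ℝ) ^ k * g (n * α))
    exact this.congr_deriv (by simp only [id]; ring)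
  · rw [norm_mul]
    exact mul_le_of_le_one_right (abs_nonneg _) (abs_cos_le_one _)

/-- Termwise differentiation of a cosine series in the parameter `α`. -/
lemma hasDerivAt_cosSeries_param {g g' : ℝ → ℝ} (hg : ExpDecay g) (hg' : ExpDecay g')
    (hd : ∀ x ≠ 0, HasDerivAt g (g' x) x) (k : ℕ) (t : ℝ) {α : ℝ} (hα : 0 < α) :
    HasDerivAt (fun β => cosSeries g k β t) (cosSeries g' (k + 1) α t) α := by
  have hα2 : 0 < α / 2 := by linarith
  obtain ⟨M, hM⟩ := hg' (α / 2) hα2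
  have hM0 : 0 ≤ M := by
    by_contra! h
    have := (abs_nonneg _).trans (hM (α / 2) (le_abs_self _))
    nlinarith [exp_pos (-|α / 2|)]
  refine hasDerivAt_tsum_of_isPreconnected (𝕜 := ℝ)
    (g := fun (n : ℤ) β => (n : ℝ) ^ k * g (n * β) * cos (n * t))
    (g' := fun (n : ℤ) β => (n : ℝ) ^ (k + 1) * g' (n * β) * cos (n * t))
    (t := Set.Ioi (α / 2)) (y₀ := α)
    ((summable_abs_int_pow_mul_exp (k + 1) hα2).mul_left M) isOpen_Ioi isPreconnected_Ioi
    (fun n y hy => ?_) (fun n y hy => ?_) (by simpa using hα)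
    (summable_mul_cos (hg.summable k hα) t) (by simpa using hα)
  · have hy0 : 0 < y := hα2.trans hy
    rcases eq_or_ne n 0 with rfl | hn
    · simpa using hasDerivAt_const y (((0 : ℤ) : ℝ) ^ k * g 0)
    · have hn' : (n : ℝ) * y ≠ 0 := mul_ne_zero (by exact_mod_cast hn) hy0.ne'
      have h1 : HasDerivAt (fun z : ℝ => (n : ℝ) * z) n y := by
        simpa using (hasDerivAt_id y).const_mul (n : ℝ)
      have := (((hd _ hn').comp y h1).const_mul ((n : ℝ) ^ k)).mul_const (cos (n * t))
      exact this.congr_deriv (by ring)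
  · have hy0 : 0 < y := hα2.trans hy
    rcases eq_or_ne n 0 with rfl | hn
    · simp
    · have h1 : (1 : ℝ) ≤ |(n : ℝ)| := by
        rw [← Int.cast_abs]; exact_mod_cast Int.one_le_abs hn
      have hy' : α / 2 < y := hy
      have h2 := hM (n * y) (by rw [abs_mul, abs_of_pos hy0]; nlinarith)
      have h3 : exp (-|(n : ℝ) * y|) ≤ exp (-(|(n : ℝ)| * (α / 2))) := by
        rw [abs_mul, abs_of_pos hy0]
        apply exp_le_exp.mpr
        nlinarith
      rw [norm_mul, norm_mul, norm_pow]
      calc _ ≤ |(n : ℝ)| ^ (k + 1) * |g' (n * y)| :=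
            mul_le_of_le_one_right (by positivity) (abs_cos_le_one _)
        _ ≤ |(n : ℝ)| ^ (k + 1) * (M * exp (-(|(n : ℝ)| * (α / 2)))) := by
            gcongr; exact h2.trans (by gcongr)
        _ = _ := by ring

/-- Product of two pairs of trigonometric series as a convolution. -/
lemma cos_mul_cos_sub_sin_mul_sin {A B : ℤ → ℝ} (hA : Summable A) (hB : Summable B) (t : ℝ) :
    (∑' n : ℤ, A n * cos (n * t)) * (∑' n : ℤ, B n * cos (n * t))
      - (∑' n : ℤ, A n * sin (n * t)) * (∑' n : ℤ, B n * sin (n * t))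
      = ∑' N : ℤ, (∑' n : ℤ, A n * B (N - n)) * cos (N * t) := by
  have hcc := summable_mul_of_summable_norm
    (summable_mul_cos hA t).norm (summable_mul_cos hB t).norm
  have hss := summable_mul_of_summable_norm
    (summable_mul_sin hA t).norm (summable_mul_sin hB t).norm
  rw [tsum_mul_tsum_of_summable_norm (summable_mul_cos hA t).norm (summable_mul_cos hB t).norm,
    tsum_mul_tsum_of_summable_norm (summable_mul_sin hA t).norm (summable_mul_sin hB t).norm,
    ← hcc.tsum_sub hss]
  let e : ℤ × ℤ ≃ ℤ × ℤ :=
    { toFun := fun p => (p.2, p.1 - p.2)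
      invFun := fun p => (p.1 + p.2, p.1)
      left_inv := fun p => by simp
      right_inv := fun p => by simp }
  have hs := hcc.sub hss
  rw [← e.tsum_eq]
  rw [← e.summable_iff] at hs
  have key : ∀ p : ℤ × ℤ, A (e p).1 * cos ((e p).1 * t) * (B (e p).2 * cos ((e p).2 * t)) -
      A (e p).1 * sin ((e p).1 * t) * (B (e p).2 * sin ((e p).2 * t))
      = A p.2 * B (p.1 - p.2) * cos (p.1 * t) := by
    intro p
    have : (p.1 : ℝ) * t = p.2 * t + ((p.1 - p.2 : ℤ) : ℝ) * t := by push_cast; ring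
    rw [this, cos_add]
    simp only [e, Equiv.coe_fn_mk]
    ring
  have hs' : Summable fun p : ℤ × ℤ => A p.2 * B (p.1 - p.2) * cos (p.1 * t) :=
    hs.congr key
  rw [tsum_congr key, hs'.tsum_prod]
  exact tsum_congr fun N => by rw [← tsum_mul_right]

lemma summable_conv {A B : ℤ → ℝ} (hA : Summable A) (hB : Summable B) (N : ℤ) :
    Summable (fun n : ℤ => A n * B (N - n)) := by
  have h : Summable (fun n : ℤ => B (N - n)) := (Equiv.subLeft N).summable_iff.mpr hB
  have := (summable_mul_of_summable_norm hA.norm h.norm)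
  exact this.comp_injective (i := fun n : ℤ => (n, n)) fun a b h => (Prod.mk.inj h).1

lemma tsum_eq_zero_of_odd {f : ℤ → ℝ} (hf : ∀ n, f (-n) = -f n) : ∑' n, f n = 0 := by
  have h := (Equiv.neg ℤ).tsum_eq f
  simp only [Equiv.neg_apply, hf, tsum_neg] at h
  linarith

noncomputable def sech (x : ℝ) : ℝ := (cosh x)⁻¹

noncomputable def csch (x : ℝ) : ℝ := (sinh x)⁻¹

noncomputable def coth (x : ℝ) : ℝ := cosh x / sinh x

lemma expDecay_sech : ExpDecay sech := expDecay_inv_cosh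

lemma expDecay_csch : ExpDecay csch := expDecay_inv_sinh

lemma sech_neg (x : ℝ) : sech (-x) = sech x := by simp [sech]

lemma csch_neg (x : ℝ) : csch (-x) = -csch x := by simp [csch, inv_neg]

lemma csch_zero : csch 0 = 0 := by simp [csch]

lemma coth_neg (x : ℝ) : coth (-x) = -coth x := by simp [coth, div_neg]

lemma coth_zero : coth 0 = 0 := by simp [coth]

lemma hasSum_of_eq {f g : ℤ → ℝ} {a b : ℝ} (hf : HasSum f a) (h : ∀ n, g n = f n) (hab : b = a) :
    HasSum g b := by
  rw [hab, funext h]; exact hf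

section Telescoping

variable {T : ℤ → ℝ}

lemma hasSum_sub_one (hT : Summable fun n : ℤ => T n - (n.sign : ℝ)) :
    HasSum (fun n : ℤ => T n - T (n - 1)) 2 := by
  have h1 := hT.hasSum
  have h2 : HasSum (fun n : ℤ => T (n - 1) - ((n - 1).sign : ℝ)) _ :=
    (Equiv.subRight (1 : ℤ)).hasSum_iff.mpr h1
  have h3 := h1.sub h2
  have h4 := (hasSum_ite_eq (0 : ℤ) (1 : ℝ)).add (hasSum_ite_eq (1 : ℤ) (1 : ℝ))
  have h5 := h3.add h4
  refine hasSum_of_eq h5 (fun n => ?_) (by norm_num)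
  · have : (((n : ℤ).sign : ℤ) : ℝ) - (((n - 1 : ℤ).sign : ℤ) : ℝ) =
        (if n = 0 then 1 else 0) + (if n = 1 then 1 else 0) := by
      rcases lt_trichotomy n 0 with h | rfl | h
      · rw [Int.sign_eq_neg_one_of_neg h, Int.sign_eq_neg_one_of_neg (by omega),
          if_neg (by omega), if_neg (by omega)]; simp
      · simp
      · rcases eq_or_ne n 1 with rfl | h1
        · simp
        · rw [Int.sign_eq_one_of_pos h, Int.sign_eq_one_of_pos (by omega),
            if_neg (by omega), if_neg (by omega)]; simp
    linarith

lemma hasSum_sub_shift (hT : Summable fun n : ℤ => T n - (n.sign : ℝ)) (N : ℤ) :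
    HasSum (fun n : ℤ => T n - T (n - N)) (2 * N) := by
  have h1 := hasSum_sub_one hT
  have step (N : ℤ) : HasSum (fun n : ℤ => T (n - N) - T (n - (N + 1))) 2 := by
    have := (Equiv.subRight N).hasSum_iff.mpr h1
    convert this using 1
    funext (n : ℤ)
    simp only [Function.comp_apply, Equiv.subRight_apply, sub_sub]
  induction N using Int.induction_on with
  | zero => simp
  | succ i ih =>
    have := ih.add (step i)
    convert this using 1
    · funext (n : ℤ); ring
    · push_cast; ring
  | pred i ih =>
    have := ih.sub (step (-i - 1))
    refine hasSum_of_eq this (fun n => ?_) (by push_cast; ring)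
    rw [sub_add_cancel]; ring

end Telescoping

variable {α : ℝ}

lemma int_mul_ne_zero (hα : 0 < α) {n : ℤ} (hn : n ≠ 0) : (n : ℝ) * α ≠ 0 :=
  mul_ne_zero (by exact_mod_cast hn) hα.ne'

lemma abs_tanh_sub_sign_le (hα : 0 < α) (n : ℤ) :
    |tanh (n * α) - (n.sign : ℝ)| ≤ sech (n * α) := by
  have hpos : ∀ x : ℝ, 0 < x → |tanh x - 1| ≤ sech x := by
    intro x hx
    have h : tanh x - 1 = -(exp (-x) * sech x) := by
      rw [tanh_eq_sinh_div_cosh, sech, ← cosh_sub_sinh]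
      field_simp [(cosh_pos x).ne']
      ring
    rw [h, abs_neg, abs_mul, abs_of_pos (exp_pos _), sech,
      abs_of_pos (inv_pos.mpr (cosh_pos x))]
    exact mul_le_of_le_one_left (inv_pos.mpr (cosh_pos x)).le (exp_le_one_iff.mpr (by linarith))
  rcases lt_trichotomy n 0 with h | rfl | h
  · have h' : (n : ℝ) < 0 := by exact_mod_cast h
    have := hpos (-(n * α)) (by nlinarith)
    rw [Int.sign_eq_neg_one_of_neg h]
    rw [tanh_neg, sech_neg] at this
    rw [← abs_neg]
    convert this using 2
    push_cast; ring
  · simp [sech]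
  · have h' : (0 : ℝ) < n := by exact_mod_cast h
    have := hpos (n * α) (by positivity)
    rwa [Int.sign_eq_one_of_pos h, Int.cast_one]

lemma summable_sech (hα : 0 < α) : Summable (fun n : ℤ => sech (n * α)) := by
  simpa using expDecay_sech.summable 0 hα

lemma summable_csch (hα : 0 < α) : Summable (fun n : ℤ => csch (n * α)) := by
  simpa using expDecay_csch.summable 0 hα

lemma summable_mul_sech (hα : 0 < α) : Summable (fun n : ℤ => n * sech (n * α)) := by
  simpa using expDecay_sech.summable 1 hα

lemma summable_mul_csch (hα : 0 < α) : Summable (fun n : ℤ => n * csch (n * α)) := by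
  simpa using expDecay_csch.summable 1 hα

lemma coth_sub_tanh (x : ℝ) : coth x - tanh x = csch x * sech x := by
  rcases eq_or_ne x 0 with rfl | hx
  · simp [coth, csch]
  · have h1 : sinh x ≠ 0 := by rwa [Ne, sinh_eq_zero]
    have h2 := (cosh_pos x).ne'
    have h3 := cosh_sq x
    rw [coth, csch, sech, tanh_eq_sinh_div_cosh]
    field_simp
    linarith

lemma bddAway_sech : BddAway sech := expDecay_sech.bddAway

lemma summable_csch_mul_sech (hα : 0 < α) (k : ℕ) :
    Summable (fun n : ℤ => (n : ℝ) ^ k * (csch (n * α) * sech (n * α))) :=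
  (expDecay_csch.mul_bdd bddAway_sech).summable k hα

lemma summable_tanh_sub_sign (hα : 0 < α) :
    Summable fun n : ℤ => tanh (n * α) - (n.sign : ℝ) :=
  Summable.of_norm_bounded (summable_sech hα) fun n => abs_tanh_sub_sign_le hα n

lemma summable_coth_sub_sign (hα : 0 < α) :
    Summable fun n : ℤ => coth (n * α) - (n.sign : ℝ) := by
  have h := (summable_tanh_sub_sign hα).add (summable_csch_mul_sech hα 0)
  refine h.congr fun n => ?_
  rw [← coth_sub_tanh]; ring

lemma tanh_sub_tanh (x y : ℝ) : tanh x - tanh y = sinh (x - y) * (sech x * sech y) := by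
  have h1 := (cosh_pos x).ne'
  have h2 := (cosh_pos y).ne'
  rw [sinh_sub, sech, sech, tanh_eq_sinh_div_cosh, tanh_eq_sinh_div_cosh]
  field_simp

lemma tanh_shift (α : ℝ) (n N : ℤ) :
    tanh (n * α) - tanh ((n - N : ℤ) * α) =
      sinh (N * α) * (sech (n * α) * sech ((N - n : ℤ) * α)) := by
  have h : ((N - n : ℤ) : ℝ) * α = -(((n - N : ℤ) : ℝ) * α) := by push_cast; ring
  rw [h, sech_neg, tanh_sub_tanh]
  congr 2
  push_cast; ring

lemma hasSum_tanh_shift (hα : 0 < α) (N : ℤ) :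
    HasSum (fun n : ℤ => tanh (n * α) - tanh ((n - N : ℤ) * α)) (2 * N) :=
  hasSum_sub_shift (T := fun n : ℤ => tanh (n * α)) (summable_tanh_sub_sign hα) N

lemma hasSum_coth_shift (hα : 0 < α) (N : ℤ) :
    HasSum (fun n : ℤ => coth (n * α) - coth ((n - N : ℤ) * α)) (2 * N) :=
  hasSum_sub_shift (T := fun n : ℤ => coth (n * α)) (summable_coth_sub_sign hα) N

lemma hasSum_mul_tanh_shift (hα : 0 < α) (N : ℤ) :
    HasSum (fun n : ℤ => n * (tanh (n * α) - tanh ((n - N : ℤ) * α))) ((N : ℝ) ^ 2) := by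
  have hs : Summable (fun n : ℤ => n * (tanh (n * α) - tanh ((n - N : ℤ) * α))) := by
    refine ((summable_conv (summable_mul_sech hα) (summable_sech hα) N).mul_left
      (sinh (N * α))).congr fun n => ?_
    rw [tanh_shift]; ring
  obtain ⟨X, hX⟩ := hs
  have h2 := (Equiv.subLeft N).hasSum_iff.mpr hX
  have h3 := ((hasSum_tanh_shift hα N).mul_left (N : ℝ)).sub hX
  have h4 : X = N * (2 * N) - X := by
    refine h2.unique (hasSum_of_eq h3 (fun n => ?_) rfl)
    have e1 : ((N - n : ℤ) : ℝ) * α = -((n - N : ℤ) * α) := by push_cast; ring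
    have e2 : ((N - n - N : ℤ) : ℝ) * α = -(n * α) := by push_cast; ring
    simp only [Function.comp_apply, Equiv.subLeft_apply, e1, e2, tanh_neg]
    push_cast; ring
  have : X = (N : ℝ) ^ 2 := by linarith
  rwa [this] at hX

lemma sinh_int_mul_ne_zero (hα : 0 < α) {n : ℤ} (hn : n ≠ 0) : sinh (n * α) ≠ 0 := by
  rw [Ne, sinh_eq_zero]; exact int_mul_ne_zero hα hn

/-- The constant Fourier coefficient of the square of the `sech` series. -/
noncomputable def sechSqSum (α : ℝ) : ℝ := ∑' n : ℤ, sech (n * α) ^ 2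

noncomputable def cschSechSum (α : ℝ) : ℝ := ∑' n : ℤ, (n : ℝ) * (csch (n * α) * sech (n * α))

lemma tsum_sech_conv_sech (hα : 0 < α) (N : ℤ) :
    ∑' n : ℤ, sech (n * α) * sech ((N - n : ℤ) * α) =
      2 * (N * csch (N * α)) + if N = 0 then sechSqSum α else 0 := by
  rcases eq_or_ne N 0 with rfl | hN
  · simp only [zero_sub, Int.cast_neg, neg_mul, sech_neg, sechSqSum, if_true, Int.cast_zero,
      zero_mul, mul_zero, zero_add, sq]
  · have h := (hasSum_tanh_shift hα N).tsum_eq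
    simp only [tanh_shift, tsum_mul_left] at h
    rw [if_neg hN, csch, add_zero]
    have := sinh_int_mul_ne_zero hα hN
    rw [← mul_assoc, ← div_eq_mul_inv, eq_div_iff this, mul_comm]
    exact h

lemma cos_int_add_one_mul_pi (n : ℤ) : cos ((n + 1 : ℤ) * π) = -cos (n * π) := by
  rw [← cos_add_pi]; congr 1; push_cast; ring

lemma cos_int_mul_pi_mul_self (n : ℤ) : cos (n * π) * cos (n * π) = 1 := by
  have := sin_sq_add_cos_sq (n * π)
  rw [sin_int_mul_pi] at this
  linarith

lemma cos_int_sub_mul_pi (N n : ℤ) : cos ((N - n : ℤ) * π) = cos (N * π) * cos (n * π) := by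
  push_cast
  rw [sub_mul, cos_sub, sin_int_mul_pi]; ring

lemma tsum_alternating_tanh_shift_odd {N : ℤ} (hN : cos (N * π) = -1) :
    ∑' n : ℤ, cos (n * π) * (tanh (n * α) - tanh ((n - N : ℤ) * α)) = 0 := by
  have h := (Equiv.subLeft N).tsum_eq
    (fun n : ℤ => cos (n * π) * (tanh (n * α) - tanh ((n - N : ℤ) * α)))
  have h2 : ∀ n : ℤ, cos ((N - n : ℤ) * π) *
      (tanh ((N - n : ℤ) * α) - tanh ((N - n - N : ℤ) * α)) =
      -(cos (n * π) * (tanh (n * α) - tanh ((n - N : ℤ) * α))) := by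
    intro n
    rw [cos_int_sub_mul_pi, hN]
    have e1 : ((N - n : ℤ) : ℝ) * α = -((n - N : ℤ) * α) := by push_cast; ring
    have e2 : ((N - n - N : ℤ) : ℝ) * α = -(n * α) := by push_cast; ring
    rw [e1, e2, tanh_neg, tanh_neg]; ring
  simp only [Equiv.subLeft_apply, h2, tsum_neg] at h
  linarith

lemma tsum_alternating_tanh_shift (hα : 0 < α) (N : ℤ) :
    ∑' n : ℤ, cos (n * π) * (tanh (n * α) - tanh ((n - N : ℤ) * α)) = 0 := by
  rcases mul_self_eq_one_iff.mp (cos_int_mul_pi_mul_self N) with hN | hN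
  · have hs (M : ℤ) := summable_mul_cos (hasSum_tanh_shift hα M).summable π
    have h1 := tsum_alternating_tanh_shift_odd (α := α) (N := 1) (by simp)
    have h2 := tsum_alternating_tanh_shift_odd (α := α) (N := N + 1)
      (by rw [cos_int_add_one_mul_pi, hN])
    have h3 := (Equiv.subRight (1 : ℤ)).tsum_eq
      (fun n : ℤ => cos (n * π) * (tanh (n * α) - tanh ((n - N : ℤ) * α)))
    have hs1 : Summable fun n : ℤ => cos (n * π) * (tanh (n * α) - tanh ((n - 1 : ℤ) * α)) := by
      simpa only [mul_comm] using hs 1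
    have hs2 : Summable fun n : ℤ =>
        cos (n * π) * (tanh (n * α) - tanh ((n - (N + 1) : ℤ) * α)) := by
      simpa only [mul_comm] using hs (N + 1)
    have h4 : ∀ n : ℤ, cos ((n - 1 : ℤ) * π) *
        (tanh ((n - 1 : ℤ) * α) - tanh ((n - 1 - N : ℤ) * α)) =
        cos (n * π) * (tanh (n * α) - tanh ((n - 1 : ℤ) * α)) -
        cos (n * π) * (tanh (n * α) - tanh ((n - (N + 1) : ℤ) * α)) := by
      intro n
      have e : cos (n * π) = -cos ((n - 1 : ℤ) * π) := by
        rw [← cos_int_add_one_mul_pi, sub_add_cancel]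
      rw [e, show n - (N + 1) = n - 1 - N by ring]; ring
    simp only [Equiv.subRight_apply, h4] at h3
    rw [← h3, hs1.tsum_sub hs2, h1, h2, sub_zero]
  · exact tsum_alternating_tanh_shift_odd hN

lemma tsum_sech_conv_alternating (hα : 0 < α) {N : ℤ} (hN : N ≠ 0) :
    ∑' n : ℤ, sech (n * α) * (cos ((N - n : ℤ) * π) * sech ((N - n : ℤ) * α)) = 0 := by
  have h := tsum_alternating_tanh_shift hα N
  simp only [tanh_shift] at h
  have h2 : ∀ n : ℤ, cos (n * π) * (sinh (N * α) * (sech (n * α) * sech ((N - n : ℤ) * α))) =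
    sinh (N * α) * cos (N * π) *
      (sech (n * α) * (cos ((N - n : ℤ) * π) * sech ((N - n : ℤ) * α))) := by
    intro n
    rw [cos_int_sub_mul_pi]
    have := cos_int_mul_pi_mul_self N
    linear_combination
      (-(sinh (N * α) * cos (n * π) * (sech (n * α) * sech ((N - n : ℤ) * α)))) * this
  simp only [h2, tsum_mul_left] at h
  refine (mul_eq_zero.mp h).resolve_left (mul_ne_zero (sinh_int_mul_ne_zero hα hN) ?_)
  intro h0
  have := cos_int_mul_pi_mul_self N
  rw [h0] at this; norm_num at this

lemma csch_mul_sech_shift (hα : 0 < α) {n : ℤ} (hn : n ≠ 0) (N : ℤ) :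
    csch (n * α) * sech ((N - n : ℤ) * α) =
      sech (N * α) * (coth (n * α) - tanh ((n - N : ℤ) * α)) := by
  have e : ((N : ℤ) : ℝ) * α = n * α + (N - n : ℤ) * α := by push_cast; ring
  have e1 : ((n - N : ℤ) : ℝ) * α = -((N - n : ℤ) * α) := by push_cast; ring
  have h1 := sinh_int_mul_ne_zero hα hn
  have h2 := (cosh_pos ((N - n : ℤ) * α)).ne'
  have h3 := (cosh_pos (n * α + (N - n : ℤ) * α)).ne'
  rw [e1, e, tanh_neg, csch, sech, sech, coth, tanh_eq_sinh_div_cosh]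
  generalize (n : ℝ) * α = x at *
  generalize ((N - n : ℤ) : ℝ) * α = y at *
  field_simp
  rw [cosh_add]; ring

lemma tsum_csch_conv_sech (hα : 0 < α) (N : ℤ) :
    ∑' n : ℤ, (2 * (n * csch (n * α)) + if n = 0 then sechSqSum α else 0) *
        sech ((N - n : ℤ) * α) =
      sech (N * α) * (sechSqSum α + 2 * cschSechSum α + 2 * (N : ℝ) ^ 2) := by
  have h1 := (summable_csch_mul_sech hα 1).hasSum.mul_left 2
  have h2 := (hasSum_mul_tanh_shift hα N).mul_left 2
  have h3 := hasSum_ite_eq (0 : ℤ) (sechSqSum α)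
  have h := ((h1.add h2).add h3).mul_left (sech (N * α))
  simp only [pow_one] at h
  have key : ∀ n : ℤ, (2 * (n * csch (n * α)) + if n = 0 then sechSqSum α else 0) *
        sech ((N - n : ℤ) * α) = sech (N * α) * (2 * (n * (csch (n * α) * sech (n * α))) +
        2 * (n * (tanh (n * α) - tanh ((n - N : ℤ) * α))) + if n = 0 then sechSqSum α else 0) := by
    intro n
    rcases eq_or_ne n 0 with rfl | hn
    · simp; ring
    · rw [if_neg hn, ← coth_sub_tanh, add_zero, add_zero]
      linear_combination 2 * n * csch_mul_sech_shift hα hn N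
  rw [tsum_congr key, h.tsum_eq, cschSechSum]
  ring

lemma tsum_csch_conv_mul_sech (hα : 0 < α) (N : ℤ) :
    ∑' n : ℤ, csch (n * α) * ((N - n : ℤ) * sech ((N - n : ℤ) * α)) =
      sech (N * α) * (-cschSechSum α + (N : ℝ) ^ 2 - N * tanh (N * α)) := by
  have hodd : ∑' n : ℤ, csch (n * α) * sech (n * α) = 0 := tsum_eq_zero_of_odd fun n => by
    rw [Int.cast_neg, neg_mul, csch_neg, sech_neg]; ring
  have h0 := (summable_csch_mul_sech hα 0).hasSum.mul_left (N : ℝ)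
  have h1 := (summable_csch_mul_sech hα 1).hasSum
  have h2 := hasSum_mul_tanh_shift hα N
  have h3 := (hasSum_tanh_shift hα N).mul_left (N : ℝ)
  have h4 := hasSum_ite_eq (0 : ℤ) (N * tanh (N * α))
  simp only [pow_one, pow_zero, one_mul] at h0 h1
  rw [hodd] at h0
  have h := ((((h0.sub h1).add h3).sub h2).sub h4).mul_left (sech (N * α))
  have key : ∀ n : ℤ, csch (n * α) * ((N - n : ℤ) * sech ((N - n : ℤ) * α)) =
      sech (N * α) * (N * (csch (n * α) * sech (n * α)) - n * (csch (n * α) * sech (n * α)) +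
        N * (tanh (n * α) - tanh ((n - N : ℤ) * α)) -
        n * (tanh (n * α) - tanh ((n - N : ℤ) * α)) - if n = 0 then N * tanh (N * α) else 0) := by
    intro n
    rcases eq_or_ne n 0 with rfl | hn
    · simp [csch_zero]
    · rw [if_neg hn, ← coth_sub_tanh, sub_zero]
      push_cast
      have := csch_mul_sech_shift hα hn N
      push_cast at this
      linear_combination (N - n : ℝ) * this
  rw [tsum_congr key, h.tsum_eq, cschSechSum]
  ring

lemma csch_mul_csch_shift (hα : 0 < α) {n N : ℤ} (hn : n ≠ 0) (hN : N ≠ 0) (h : n ≠ N) :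
    csch (n * α) * csch ((N - n : ℤ) * α) =
      csch (N * α) * (coth (n * α) - coth ((n - N : ℤ) * α)) := by
  have e1 : ((n - N : ℤ) : ℝ) * α = -((N - n : ℤ) * α) := by push_cast; ring
  have h1 := sinh_int_mul_ne_zero hα hn
  have h2 := sinh_int_mul_ne_zero hα (sub_ne_zero.mpr h.symm)
  have h3 := sinh_int_mul_ne_zero hα hN
  have e : ((N : ℤ) : ℝ) * α = n * α + (N - n : ℤ) * α := by push_cast; ring
  rw [e] at h3
  rw [e1, e, coth_neg, csch, csch, csch, coth, coth]
  generalize (n : ℝ) * α = x at *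
  generalize ((N - n : ℤ) : ℝ) * α = y at *
  field_simp
  rw [sinh_add]; ring

lemma tsum_csch_conv_csch (hα : 0 < α) {N : ℤ} (hN : N ≠ 0) :
    ∑' n : ℤ, csch (n * α) * csch ((N - n : ℤ) * α) =
      2 * csch (N * α) * (N - coth (N * α)) := by
  have h1 := hasSum_coth_shift hα N
  have h2 := hasSum_ite_eq (0 : ℤ) (coth (N * α))
  have h3 := hasSum_ite_eq N (coth (N * α))
  have h := ((h1.sub h2).sub h3).mul_left (csch (N * α))
  have key : ∀ n : ℤ, csch (n * α) * csch ((N - n : ℤ) * α) =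
      csch (N * α) * (coth (n * α) - coth ((n - N : ℤ) * α) -
        (if n = 0 then coth (N * α) else 0) - if n = N then coth (N * α) else 0) := by
    intro n
    rcases eq_or_ne n 0 with rfl | hn
    · simp [csch_zero, coth_zero, coth_neg, hN.symm]
    rcases eq_or_ne n N with rfl | hn'
    · simp [csch_zero, coth_zero, hN]
    rw [if_neg hn, if_neg hn', sub_zero, sub_zero, csch_mul_csch_shift hα hn hN hn']
  rw [tsum_congr key, h.tsum_eq]
  ring

lemma summable_tsum_conv {A B : ℤ → ℝ} (hA : Summable A) (hB : Summable B) :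
    Summable (fun N : ℤ => ∑' n : ℤ, A n * B (N - n)) := by
  let e : ℤ × ℤ ≃ ℤ × ℤ :=
    { toFun := fun p => (p.2, p.1 - p.2)
      invFun := fun p => (p.1 + p.2, p.1)
      left_inv := fun p => by simp
      right_inv := fun p => by simp }
  have h := e.summable_iff.mpr (summable_mul_of_summable_norm hA.norm hB.norm)
  exact h.prod

lemma tsum_even_mul_sin {A : ℤ → ℝ} (hA : ∀ n, A (-n) = A n) (t : ℝ) :
    ∑' n : ℤ, A n * sin (n * t) = 0 :=
  tsum_eq_zero_of_odd fun n => by rw [hA]; push_cast; rw [neg_mul, sin_neg]; ring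

lemma tsum_odd_mul_cos {A : ℤ → ℝ} (hA : ∀ n, A (-n) = -A n) (t : ℝ) :
    ∑' n : ℤ, A n * cos (n * t) = 0 :=
  tsum_eq_zero_of_odd fun n => by rw [hA]; push_cast; rw [neg_mul (n : ℝ) t, cos_neg]; ring

lemma sech_int_neg (α : ℝ) (n : ℤ) : sech ((-n : ℤ) * α) = sech (n * α) := by
  rw [Int.cast_neg, neg_mul, sech_neg]

lemma csch_int_neg (α : ℝ) (n : ℤ) : csch ((-n : ℤ) * α) = -csch (n * α) := by
  rw [Int.cast_neg, neg_mul, csch_neg]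

/-- The function `∑ cos (n t) / cosh (n α)`, a multiple of the Jacobi function `dn`. -/
noncomputable def dnSeries (α t : ℝ) : ℝ := cosSeries sech 0 α t

lemma dnSeries_eq (α t : ℝ) : dnSeries α t = ∑' n : ℤ, sech (n * α) * cos (n * t) := by
  simp [dnSeries, cosSeries]

lemma tsum_ite_mul_cos (a t : ℝ) : ∑' n : ℤ, (if n = 0 then a else 0) * cos (n * t) = a := by
  rw [tsum_eq_single 0 (fun n hn => by rw [if_neg hn, zero_mul])]
  simp

lemma summable_ite (a : ℝ) : Summable (fun n : ℤ => if n = 0 then a else 0) :=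
  (hasSum_ite_eq (0 : ℤ) a).summable

lemma tsum_sq_coeff_mul_cos (hα : 0 < α) (t : ℝ) :
    ∑' n : ℤ, (2 * (n * csch (n * α)) + if n = 0 then sechSqSum α else 0) * cos (n * t) =
      sechSqSum α + 2 * cosSeries csch 1 α t := by
  simp only [add_mul]
  rw [((summable_mul_cos ((summable_mul_csch hα).mul_left 2) t)).tsum_add
    (summable_mul_cos (summable_ite _) t), tsum_ite_mul_cos]
  simp only [mul_assoc, tsum_mul_left, cosSeries, pow_one]
  ring

lemma dnSeries_sq (hα : 0 < α) (t : ℝ) :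
    dnSeries α t ^ 2 = sechSqSum α + 2 * cosSeries csch 1 α t := by
  have h := cos_mul_cos_sub_sin_mul_sin (summable_sech hα) (summable_sech hα) t
  simp only [tsum_sech_conv_sech hα] at h
  rw [tsum_even_mul_sin (sech_int_neg α), ← dnSeries_eq, tsum_sq_coeff_mul_cos hα] at h
  rw [← h]; ring

/-- The linear coefficient in the second-order differential equation of `dnSeries`. -/
noncomputable def odeCoeff (α : ℝ) : ℝ := sechSqSum α + 2 * cschSechSum α

lemma dnSeries_cube (hα : 0 < α) (t : ℝ) :
    dnSeries α t ^ 3 = odeCoeff α * dnSeries α t + 2 * cosSeries sech 2 α t := by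
  have h := cos_mul_cos_sub_sin_mul_sin
    (((summable_mul_csch hα).mul_left 2).add (summable_ite (sechSqSum α))) (summable_sech hα) t
  simp only [tsum_csch_conv_sech hα] at h
  rw [tsum_even_mul_sin (A := fun n : ℤ => sech (n * α)) (sech_int_neg α), mul_zero, sub_zero,
    ← dnSeries_eq, tsum_sq_coeff_mul_cos hα,
    ← dnSeries_sq hα] at h
  have h2 : ∑' n : ℤ, sech (n * α) * (sechSqSum α + 2 * cschSechSum α + 2 * (n : ℝ) ^ 2) *
      cos (n * t) = odeCoeff α * dnSeries α t + 2 * cosSeries sech 2 α t := by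
    rw [dnSeries_eq, cosSeries, ← tsum_mul_left, ← tsum_mul_left, ← Summable.tsum_add
      ((summable_mul_cos (summable_sech hα) t).mul_left _)
      ((summable_mul_cos (expDecay_sech.summable 2 hα) t).mul_left _)]
    exact tsum_congr fun n => by rw [odeCoeff]; ring
  rw [← h2, ← h]; ring

lemma dnSeries_mul_add_pi (hα : 0 < α) (t : ℝ) :
    dnSeries α t * dnSeries α (t + π) = dnSeries α 0 * dnSeries α π := by
  have hε : Summable fun n : ℤ => cos (n * π) * sech (n * α) := by
    simpa only [mul_comm] using summable_mul_cos (summable_sech hα) π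
  have key (t : ℝ) : dnSeries α t * dnSeries α (t + π) =
      ∑' n : ℤ, sech (n * α) * (cos ((0 - n : ℤ) * π) * sech ((0 - n : ℤ) * α)) := by
    have h := cos_mul_cos_sub_sin_mul_sin (summable_sech hα) hε t
    have h0 := tsum_eq_single (L := .unconditional ℤ) (f := fun N : ℤ => (∑' n : ℤ, sech (n * α) *
      (cos ((N - n : ℤ) * π) * sech ((N - n : ℤ) * α))) * cos (N * t)) 0
      (fun N hN => by rw [tsum_sech_conv_alternating hα hN, zero_mul])
    rw [tsum_even_mul_sin (sech_int_neg α), ← dnSeries_eq, zero_mul, sub_zero, h0] at h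
    have h2 : dnSeries α (t + π) = ∑' n : ℤ, cos (n * π) * sech (n * α) * cos (n * t) := by
      rw [dnSeries_eq]
      refine tsum_congr fun n => ?_
      rw [mul_add, cos_add, sin_int_mul_pi]; ring
    rw [h2, h]; simp
  rw [key t, ← key 0, zero_add]

lemma cosSeries_dsech_eq (hα : 0 < α) {t : ℝ} (ht : ∀ n : ℤ, sin (n * t) = 0) :
    cosSeries (fun x => sech x * tanh x) 1 α t =
      cosSeries sech 2 α t - cschSechSum α * dnSeries α t := by
  have h := cos_mul_cos_sub_sin_mul_sin (summable_csch hα) (summable_mul_sech hα) t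
  simp only [tsum_csch_conv_mul_sech hα] at h
  rw [tsum_odd_mul_cos (csch_int_neg α)] at h
  simp only [ht, mul_zero, tsum_zero, zero_mul, sub_zero] at h
  have h1 := (summable_mul_cos (summable_sech hα) t).mul_left (cschSechSum α)
  have h2 := summable_mul_cos (expDecay_sech.summable 2 hα) t
  have h3 := summable_mul_cos ((expDecay_sech.mul_bdd bddAway_tanh).summable 1 hα) t
  have h4 : cosSeries sech 2 α t - cschSechSum α * dnSeries α t -
      cosSeries (fun x => sech x * tanh x) 1 α t = 0 := by
    rw [h, dnSeries_eq, cosSeries, cosSeries, ← tsum_mul_left, ← h2.tsum_sub h1,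
      ← (h2.sub h1).tsum_sub h3]
    exact tsum_congr fun n => by ring
  linarith

lemma cosSeries_csch_one_sq (hα : 0 < α) {t : ℝ} (ht : ∀ n : ℤ, sin (n * t) = 0) :
    cosSeries csch 1 α t ^ 2 =
      cosSeries csch 3 α t - cosSeries (fun x => csch x * coth x) 2 α t := by
  have hz := summable_csch hα
  have hz1 := summable_mul_csch hα
  have hz2 := expDecay_csch.summable 2 hα
  have e1 := cos_mul_cos_sub_sin_mul_sin hz hz2 t
  have e2 := cos_mul_cos_sub_sin_mul_sin hz1 hz1 t
  have e3 := cos_mul_cos_sub_sin_mul_sin hz2 hz t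
  rw [tsum_odd_mul_cos (A := fun n : ℤ => csch (n * α)) (csch_int_neg α)] at e1 e3
  simp only [ht, mul_zero, tsum_zero, zero_mul, sub_zero] at e1 e2 e3
  have s1 := summable_mul_cos (summable_tsum_conv hz hz2) t
  have s2 := summable_mul_cos (summable_tsum_conv hz1 hz1) t
  have s3 := summable_mul_cos (summable_tsum_conv hz2 hz) t
  have key : ∀ N : ℤ, (∑' n : ℤ, csch (n * α) * ((N - n : ℤ) ^ 2 * csch ((N - n : ℤ) * α))) *
        cos (N * t) + 2 * ((∑' n : ℤ, n * csch (n * α) * ((N - n : ℤ) * csch ((N - n : ℤ) * α))) *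
        cos (N * t)) + (∑' n : ℤ, (n : ℝ) ^ 2 * csch (n * α) * csch ((N - n : ℤ) * α)) *
        cos (N * t) = 2 * ((N : ℝ) ^ 3 * csch (N * α) * cos (N * t)) -
        2 * ((N : ℝ) ^ 2 * (csch (N * α) * coth (N * α)) * cos (N * t)) := by
    intro N
    have hN : (N : ℝ) ^ 2 * ∑' n : ℤ, csch (n * α) * csch ((N - n : ℤ) * α) =
        (N : ℝ) ^ 2 * (2 * csch (N * α) * (N - coth (N * α))) := by
      rcases eq_or_ne N 0 with rfl | hN
      · simp
      · rw [tsum_csch_conv_csch hα hN]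
    have hL : (∑' n : ℤ, csch (n * α) * ((N - n : ℤ) ^ 2 * csch ((N - n : ℤ) * α))) +
        2 * (∑' n : ℤ, n * csch (n * α) * ((N - n : ℤ) * csch ((N - n : ℤ) * α))) +
        (∑' n : ℤ, (n : ℝ) ^ 2 * csch (n * α) * csch ((N - n : ℤ) * α)) =
        (N : ℝ) ^ 2 * ∑' n : ℤ, csch (n * α) * csch ((N - n : ℤ) * α) := by
      have r1 := summable_conv hz hz2 N
      have r2 := (summable_conv hz1 hz1 N).mul_left 2
      have r3 := summable_conv hz2 hz N
      rw [← tsum_mul_left, ← tsum_mul_left, ← r1.tsum_add r2, ← (r1.add r2).tsum_add r3]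
      exact tsum_congr fun n => by push_cast; ring
    linear_combination (cos (N * t)) * (hL + hN)
  have h := tsum_congr (L := .unconditional ℤ) key
  rw [(s1.add (s2.mul_left 2)).tsum_add s3, s1.tsum_add (s2.mul_left 2), tsum_mul_left, ← e1,
    ← e2, ← e3, Summable.tsum_sub ((summable_mul_cos (expDecay_csch.summable 3 hα) t).mul_left 2)
      ((summable_mul_cos ((expDecay_csch.mul_bdd
        (show BddAway coth from bddAway_coth)).summable 2 hα) t).mul_left 2),
    tsum_mul_left, tsum_mul_left] at h
  simp only [cosSeries, pow_one]
  linarith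

/-- The derivative of `dnSeries α`. -/
noncomputable def dnSeriesDeriv (α t : ℝ) : ℝ := -sinSeries sech 1 α t

lemma hasDerivAt_dnSeries (hα : 0 < α) (t : ℝ) :
    HasDerivAt (dnSeries α) (dnSeriesDeriv α t) t :=
  hasDerivAt_cosSeries expDecay_sech 0 hα t

lemma hasDerivAt_dnSeriesDeriv (hα : 0 < α) (t : ℝ) :
    HasDerivAt (dnSeriesDeriv α)
      ((odeCoeff α * dnSeries α t - dnSeries α t ^ 3) / 2) t := by
  have h := (hasDerivAt_sinSeries expDecay_sech 1 hα t).neg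
  refine h.congr_deriv ?_
  rw [dnSeries_cube hα]; ring

lemma sinSeries_eq_zero (g : ℝ → ℝ) (k : ℕ) (α : ℝ) {t : ℝ} (ht : ∀ n : ℤ, sin (n * t) = 0) :
    sinSeries g k α t = 0 := by
  simp [sinSeries, ht]

lemma dnSeriesDeriv_zero (α : ℝ) : dnSeriesDeriv α 0 = 0 := by
  rw [dnSeriesDeriv, sinSeries_eq_zero _ _ _ (by simp), neg_zero]

lemma dnSeriesDeriv_pi (α : ℝ) : dnSeriesDeriv α π = 0 := by
  rw [dnSeriesDeriv, sinSeries_eq_zero _ _ _ sin_int_mul_pi, neg_zero]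

lemma sech_pos (x : ℝ) : 0 < sech x := inv_pos.mpr (cosh_pos x)

lemma dnSeries_lt_dnSeries_zero (hα : 0 < α) {t : ℝ} (ht : cos t < 1) :
    dnSeries α t < dnSeries α 0 := by
  have h0 := summable_mul_cos (summable_sech hα) 0
  have h1 := summable_mul_cos (summable_sech hα) t
  rw [← sub_pos, dnSeries_eq, dnSeries_eq, ← h0.tsum_sub h1]
  refine (h0.sub h1).tsum_pos (fun n => ?_) 1 ?_
  · have := mul_le_of_le_one_right (sech_pos (n * α)).le (cos_le_one (n * t))
    simpa using this
  · have := mul_lt_of_lt_one_right (sech_pos α) ht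
    simpa using this

lemma neg_dnSeries_zero_lt (hα : 0 < α) (t : ℝ) : -dnSeries α 0 < dnSeries α t := by
  have h0 := summable_mul_cos (summable_sech hα) 0
  have h1 := summable_mul_cos (summable_sech hα) t
  rw [neg_lt_iff_pos_add, dnSeries_eq, dnSeries_eq, ← h1.tsum_add h0]
  refine (h1.add h0).tsum_pos (fun n => ?_) 0 ?_
  · rw [mul_zero, cos_zero, ← mul_add]
    exact mul_nonneg (sech_pos _).le (by linarith [neg_one_le_cos (n * t)])
  · simp [sech]

lemma dnSeries_sq_lt (hα : 0 < α) {t : ℝ} (ht : cos t < 1) :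
    dnSeries α t ^ 2 < dnSeries α 0 ^ 2 :=
  sq_lt_sq' (neg_dnSeries_zero_lt hα t) (dnSeries_lt_dnSeries_zero hα ht)

lemma dnSeries_zero_pos (hα : 0 < α) : 0 < dnSeries α 0 := by
  linarith [neg_dnSeries_zero_lt hα 0]

/-- The square of `dnSeries α` at its maximum. -/
noncomputable def sqMax (α : ℝ) : ℝ := dnSeries α 0 ^ 2

/-- The square of `dnSeries α` at `π`. -/
noncomputable def sqMin (α : ℝ) : ℝ := dnSeries α π ^ 2

lemma sqMin_lt_sqMax (hα : 0 < α) : sqMin α < sqMax α := dnSeries_sq_lt hα (by simp)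

lemma sqMax_pos (hα : 0 < α) : 0 < sqMax α := pow_pos (dnSeries_zero_pos hα) 2

lemma dnSeries_first_integral (hα : 0 < α) (t₁ t₂ : ℝ) :
    dnSeriesDeriv α t₁ ^ 2 - odeCoeff α * dnSeries α t₁ ^ 2 / 2 + dnSeries α t₁ ^ 4 / 4 =
      dnSeriesDeriv α t₂ ^ 2 - odeCoeff α * dnSeries α t₂ ^ 2 / 2 + dnSeries α t₂ ^ 4 / 4 := by
  have h (t : ℝ) : HasDerivAt (fun t => dnSeriesDeriv α t ^ 2 -
      odeCoeff α * dnSeries α t ^ 2 / 2 + dnSeries α t ^ 4 / 4) 0 t := by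
    have h1 := hasDerivAt_dnSeries hα t
    have h2 := hasDerivAt_dnSeriesDeriv hα t
    exact (((h2.pow 2).sub (((h1.pow 2).const_mul (odeCoeff α)).div_const 2)).add
      ((h1.pow 4).div_const 4)).congr_deriv (by push_cast; ring)
  exact is_const_of_deriv_eq_zero (fun t => (h t).differentiableAt) (fun t => (h t).deriv) t₁ t₂

lemma two_mul_odeCoeff (hα : 0 < α) : 2 * odeCoeff α = sqMin α + sqMax α := by
  have h := dnSeries_first_integral hα 0 π
  rw [dnSeriesDeriv_zero, dnSeriesDeriv_pi] at h
  have h1 := sub_ne_zero.mpr (sqMin_lt_sqMax hα).ne'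
  refine mul_left_cancel₀ h1 ?_
  rw [sqMin, sqMax]
  linear_combination (-4) * h

lemma dnSeriesDeriv_sq (hα : 0 < α) (t : ℝ) :
    dnSeriesDeriv α t ^ 2 =
      (sqMax α - dnSeries α t ^ 2) * (dnSeries α t ^ 2 - sqMin α) / 4 := by
  have h := dnSeries_first_integral hα t 0
  have h1 := two_mul_odeCoeff hα
  rw [dnSeriesDeriv_zero] at h
  rw [sqMax] at *
  linear_combination h + (dnSeries α t ^ 2 - dnSeries α 0 ^ 2) / 4 * h1

lemma hasDerivAt_dnSeries_sq (hα : 0 < α) (t : ℝ) :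
    HasDerivAt (fun t => dnSeries α t ^ 2) (2 * (dnSeries α t * dnSeriesDeriv α t)) t :=
  ((hasDerivAt_dnSeries hα t).pow 2).congr_deriv (by push_cast; ring)

lemma hasDerivAt_deriv_dnSeries_sq (hα : 0 < α) (t : ℝ) :
    HasDerivAt (fun t => 2 * (dnSeries α t * dnSeriesDeriv α t))
      ((sqMin α + sqMax α) * dnSeries α t ^ 2 - 3 / 2 * (dnSeries α t ^ 2) ^ 2 -
        sqMin α * sqMax α / 2) t := by
  refine (((hasDerivAt_dnSeries hα t).mul (hasDerivAt_dnSeriesDeriv hα t)).const_mul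
    2).congr_deriv ?_
  have h1 := two_mul_odeCoeff hα
  have h2 := dnSeriesDeriv_sq hα t
  linear_combination 2 * h2 + dnSeries α t ^ 2 / 2 * h1

lemma sinSeries_csch_two (hα : 0 < α) (t : ℝ) :
    -sinSeries csch 2 α t = dnSeries α t * dnSeriesDeriv α t := by
  have h := hasDerivAt_dnSeries_sq hα t
  rw [funext (dnSeries_sq hα)] at h
  have h1 := ((hasDerivAt_cosSeries expDecay_csch 1 hα t).const_mul 2).const_add (sechSqSum α)
  linarith [h.unique h1]

lemma cosSeries_csch_three (hα : 0 < α) (t : ℝ) :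
    cosSeries csch 3 α t = -((sqMin α + sqMax α) * dnSeries α t ^ 2) / 2 +
      3 / 4 * (dnSeries α t ^ 2) ^ 2 + sqMin α * sqMax α / 4 := by
  have h := hasDerivAt_deriv_dnSeries_sq hα t
  rw [funext fun t => congrArg (2 * ·) (sinSeries_csch_two hα t).symm] at h
  have h1 := (hasDerivAt_sinSeries expDecay_csch 2 hα t).neg.const_mul 2
  linarith [h.unique h1]

lemma cosSeries_csch_three_pi (hα : 0 < α) :
    cosSeries csch 3 α π = -((sqMax α - sqMin α) * sqMin α) / 4 := by
  rw [cosSeries_csch_three hα, ← sqMin]; ring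

lemma sinSeries_csch_four (hα : 0 < α) (t : ℝ) :
    -sinSeries csch 4 α t = (3 / 2 * dnSeries α t ^ 2 - (sqMin α + sqMax α) / 2) *
      (2 * (dnSeries α t * dnSeriesDeriv α t)) := by
  have h := hasDerivAt_cosSeries expDecay_csch 3 hα t
  rw [funext (cosSeries_csch_three hα)] at h
  have h0 := hasDerivAt_dnSeries_sq hα t
  have h1 := (((h0.const_mul (sqMin α + sqMax α)).neg.div_const 2).add
    ((h0.pow 2).const_mul (3 / 4))).add_const (sqMin α * sqMax α / 4)
  rw [h.unique h1]; push_cast; ring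

lemma cosSeries_csch_five_pi (hα : 0 < α) :
    cosSeries csch 5 α π =
      -((sqMax α - sqMin α) * sqMin α) * (2 * sqMin α - sqMax α) / 4 := by
  have h := (hasDerivAt_sinSeries expDecay_csch 4 hα π).neg
  rw [show -sinSeries csch 4 α = _ from funext (sinSeries_csch_four hα)] at h
  have h1 := (((hasDerivAt_dnSeries_sq hα π).const_mul (3 / 2)).sub_const
    ((sqMin α + sqMax α) / 2)).mul (hasDerivAt_deriv_dnSeries_sq hα π)
  have h2 := h.unique h1
  rw [dnSeriesDeriv_pi, ← sqMin] at h2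
  linear_combination -h2

lemma cosSeries_const_mul (g : ℝ → ℝ) (r : ℝ) (k : ℕ) (α t : ℝ) :
    cosSeries (fun x => r * g x) k α t = r * cosSeries g k α t := by
  rw [cosSeries, cosSeries, ← tsum_mul_left]
  exact tsum_congr fun n => by ring

lemma cosh_ne_zero (x : ℝ) : cosh x ≠ 0 := (cosh_pos x).ne'

lemma hasDerivAt_sech (x : ℝ) : HasDerivAt sech (-1 * (sech x * tanh x)) x := by
  refine ((hasDerivAt_cosh x).inv (cosh_ne_zero x)).congr_deriv ?_
  rw [sech, tanh_eq_sinh_div_cosh]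
  have := cosh_ne_zero x
  field_simp

lemma hasDerivAt_csch {x : ℝ} (hx : x ≠ 0) : HasDerivAt csch (-1 * (csch x * coth x)) x := by
  have hx' : sinh x ≠ 0 := by rwa [Ne, sinh_eq_zero]
  refine ((hasDerivAt_sinh x).inv hx').congr_deriv ?_
  rw [csch, coth]
  field_simp

lemma expDecay_csch_mul_coth : ExpDecay fun x => csch x * coth x :=
  expDecay_csch.mul_bdd bddAway_coth

/-- The derivative of the `csch` series at `π`, up to normalization. -/
noncomputable def cschSum (α : ℝ) : ℝ := -(2 * cosSeries csch 1 α π)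

lemma sechSqSum_eq (hα : 0 < α) : sechSqSum α = sqMin α + cschSum α := by
  rw [sqMin, dnSeries_sq hα, cschSum]; ring

lemma cschSechSum_eq (hα : 0 < α) :
    cschSechSum α = (sqMax α - sqMin α - 2 * cschSum α) / 4 := by
  have h1 := two_mul_odeCoeff hα
  rw [odeCoeff, sechSqSum_eq hα] at h1
  linarith

lemma hasDerivAt_dnSeries_sq_param (hα : 0 < α) {t : ℝ} (ht : ∀ n : ℤ, sin (n * t) = 0) :
    HasDerivAt (fun β => dnSeries β t ^ 2)
      (dnSeries α t ^ 2 * (sqMax α - cschSum α - dnSeries α t ^ 2)) α := by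
  have h := hasDerivAt_cosSeries_param expDecay_sech
    ((expDecay_sech.mul_bdd bddAway_tanh).const_mul (-1)) (fun x _ => hasDerivAt_sech x) 0 t hα
  refine (h.pow 2).congr_deriv ?_
  rw [zero_add, cosSeries_const_mul, cosSeries_dsech_eq hα ht, cschSechSum_eq hα]
  have h1 := dnSeries_cube hα t
  have h2 := two_mul_odeCoeff hα
  rw [← dnSeries]
  push_cast
  linear_combination dnSeries α t * h1 + dnSeries α t ^ 2 / 2 * h2

lemma hasDerivAt_sqMax (hα : 0 < α) :
    HasDerivAt sqMax (-(sqMax α * cschSum α)) α :=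
  (hasDerivAt_dnSeries_sq_param hα (t := 0) (by simp)).congr_deriv (by rw [← sqMax]; ring)

lemma hasDerivAt_sqMin (hα : 0 < α) :
    HasDerivAt sqMin (sqMin α * (sqMax α - cschSum α - sqMin α)) α :=
  hasDerivAt_dnSeries_sq_param hα sin_int_mul_pi

/-- The product of `sqMin` with the gap between `sqMax` and `sqMin`. -/
noncomputable def gapProd (α : ℝ) : ℝ := (sqMax α - sqMin α) * sqMin α

/-- A quantity vanishing exactly when `sqMin` is half of `sqMax`. -/
noncomputable def gapDiff (α : ℝ) : ℝ := 2 * sqMin α - sqMax α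

lemma hasDerivAt_gapProd (hα : 0 < α) :
    HasDerivAt gapProd (-(gapProd α * (2 * cschSum α + gapDiff α))) α := by
  have h1 := hasDerivAt_sqMax hα
  have h2 := hasDerivAt_sqMin hα
  exact ((h1.sub h2).mul h2).congr_deriv (by simp only [gapProd, gapDiff, Pi.sub_apply]; ring)

lemma hasDerivAt_gapDiff (hα : 0 < α) :
    HasDerivAt gapDiff (2 * gapProd α - gapDiff α * cschSum α) α := by
  have h1 := hasDerivAt_sqMax hα
  have h2 := hasDerivAt_sqMin hα
  exact ((h2.const_mul 2).sub h1).congr_deriv (by simp only [gapProd, gapDiff]; ring)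

lemma hasDerivAt_cschSum (hα : 0 < α) :
    HasDerivAt cschSum (-((cschSum α ^ 2 + gapProd α) / 2)) α := by
  have h := hasDerivAt_cosSeries_param expDecay_csch (expDecay_csch_mul_coth.const_mul (-1))
    (fun x hx => hasDerivAt_csch hx) 1 π hα
  refine (h.const_mul 2).neg.congr_deriv ?_
  have h1 := cosSeries_csch_one_sq hα sin_int_mul_pi
  have h2 := cosSeries_csch_three_pi hα
  rw [cosSeries_const_mul, cschSum, gapProd, one_add_one_eq_two]
  linear_combination 2 * h2 + 2 * h1

open MeasureTheory Set in
lemma integral_sigmoid_cpow (u v : ℂ) :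
    ∫ x : ℝ, (sigmoid x * (1 - sigmoid x)) •
        ((sigmoid x : ℂ) ^ (u - 1) * (1 - (sigmoid x : ℂ)) ^ (v - 1)) =
      Complex.betaIntegral u v := by
  have h := integral_image_eq_integral_abs_deriv_smul MeasurableSet.univ
    (fun x _ => (hasDerivAt_sigmoid x).hasDerivWithinAt) sigmoid_injective.injOn
    (fun y : ℝ => (y : ℂ) ^ (u - 1) * (1 - (y : ℂ)) ^ (v - 1))
  rw [image_univ, range_sigmoid, Measure.restrict_univ] at h
  rw [Complex.betaIntegral, intervalIntegral.integral_of_le zero_le_one,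
    integral_Ioc_eq_integral_Ioo, h]
  refine integral_congr_ae (.of_forall fun x => ?_)
  have h1 := sigmoid_pos x
  have h2 := sigmoid_lt_one x
  simp only
  rw [abs_of_pos (mul_pos h1 (sub_pos.mpr h2))]

lemma ofReal_cpow_eq_exp {a : ℝ} (ha : 0 < a) (w : ℂ) :
    (a : ℂ) ^ w = Complex.exp (log a * w) := by
  rw [Complex.cpow_def_of_ne_zero (by exact_mod_cast ha.ne'), Complex.ofReal_log ha.le]

lemma sigmoid_mul_exp (x : ℝ) : sigmoid x * exp (-(x / 2)) = sech (x / 2) / 2 := by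
  rw [sigmoid_def, sech, cosh_eq, show -x = -(x / 2) + -(x / 2) by ring, exp_add, exp_neg]
  have := exp_pos (x / 2)
  generalize exp (x / 2) = y at *
  field_simp

lemma sigmoid_cpow_eq (ξ x : ℝ) :
    (sigmoid x * (1 - sigmoid x)) •
        ((sigmoid x : ℂ) ^ (1 / 2 - ξ * Complex.I - 1) *
          (1 - (sigmoid x : ℂ)) ^ (1 / 2 + ξ * Complex.I - 1)) =
      Complex.exp (-(ξ * x * Complex.I)) * (sech (x / 2) / 2 : ℝ) := by
  have h1 := sigmoid_pos x
  have h2 : 0 < 1 - sigmoid x := by linarith [sigmoid_lt_one x]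
  have h3 : log (1 - sigmoid x) = log (sigmoid x) - x := by
    rw [← sigmoid_neg, ← sigmoid_mul_rexp_neg, log_mul h1.ne' (exp_pos _).ne', log_exp]; ring
  have h4 : sigmoid x = exp (log (sigmoid x)) := (exp_log h1).symm
  have h5 : 1 - sigmoid x = exp (log (sigmoid x) - x) := by rw [← h3, exp_log h2]
  rw [← sigmoid_mul_exp, show (1 : ℂ) - sigmoid x = ((1 - sigmoid x : ℝ) : ℂ) by push_cast; rfl,
    ofReal_cpow_eq_exp h1, ofReal_cpow_eq_exp h2, h3, Complex.real_smul]
  generalize log (sigmoid x) = L at *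
  rw [h5, h4]
  push_cast
  simp only [← Complex.exp_add]
  congr 1
  ring

lemma betaIntegral_half (ξ : ℝ) :
    Complex.betaIntegral (1 / 2 - ξ * Complex.I) (1 / 2 + ξ * Complex.I) =
      (π * sech (π * ξ) : ℝ) := by
  have h := Complex.Gamma_mul_Gamma_eq_betaIntegral (s := 1 / 2 - ξ * Complex.I)
    (t := 1 / 2 + ξ * Complex.I) (by simp) (by simp)
  rw [show (1 / 2 - ξ * Complex.I) + (1 / 2 + ξ * Complex.I) = (1 : ℂ) by ring,
    Complex.Gamma_one, one_mul] at h
  rw [← h, show (1 / 2 + ξ * Complex.I) = 1 - (1 / 2 - ξ * Complex.I) by ring,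
    Complex.Gamma_mul_Gamma_one_sub,
    show (π : ℂ) * (1 / 2 - ξ * Complex.I) = π / 2 - (π * ξ : ℂ) * Complex.I by ring,
    Complex.sin_pi_div_two_sub, Complex.cos_mul_I, sech]
  push_cast
  rfl

lemma integral_exp_mul_sech (ξ : ℝ) :
    ∫ x : ℝ, Complex.exp (-(ξ * x * Complex.I)) * (sech (x / 2) / 2 : ℝ) =
      (π * sech (π * ξ) : ℝ) := by
  rw [← betaIntegral_half, ← integral_sigmoid_cpow]
  exact MeasureTheory.integral_congr_ae (.of_forall fun x => (sigmoid_cpow_eq ξ x).symm)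

open FourierTransform in
lemma fourier_sech (hα : 0 < α) (ξ : ℝ) :
    𝓕 (fun x : ℝ => (sech (x * α) : ℂ)) ξ = (π / α * sech (ξ * (π ^ 2 / α)) : ℝ) := by
  have h := MeasureTheory.Measure.integral_comp_mul_left
    (fun y : ℝ => Complex.exp (-((π * ξ / α : ℝ) * y * Complex.I)) * (sech (y / 2) / 2 : ℝ)) (2 * α)
  rw [integral_exp_mul_sech] at h
  have h2 : 𝓕 (fun x : ℝ => (sech (x * α) : ℂ)) ξ = 2 * ∫ x : ℝ,
      Complex.exp (-((π * ξ / α : ℝ) * (2 * α * x : ℝ) * Complex.I)) *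
        (sech (2 * α * x / 2) / 2 : ℝ) := by
    rw [fourier_real_eq_integral_exp_smul, ← MeasureTheory.integral_const_mul]
    refine MeasureTheory.integral_congr_ae (.of_forall fun x => ?_)
    have hα' : (α : ℂ) ≠ 0 := by exact_mod_cast hα.ne'
    simp only [smul_eq_mul]
    rw [show 2 * α * x / 2 = x * α by ring]
    push_cast
    rw [show -(π * ξ / α * (2 * α * x) * Complex.I) = -2 * π * x * ξ * Complex.I by
      field_simp]
    ring
  rw [h2, h, abs_of_pos (by positivity), Complex.real_smul]
  rw [show π * (π * ξ / α) = ξ * (π ^ 2 / α) by ring]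
  have hα' : (α : ℂ) ≠ 0 := by exact_mod_cast hα.ne'
  push_cast
  field_simp

lemma continuous_sech : Continuous sech := continuous_cosh.inv₀ cosh_ne_zero

lemma sq_div_four_le_cosh (x : ℝ) : x ^ 2 / 4 ≤ cosh x := by
  rw [← cosh_abs, ← sq_abs, cosh_eq]
  have h1 := quadratic_le_exp_of_nonneg (abs_nonneg x)
  linarith [exp_pos (-|x|), abs_nonneg x]

open Filter Asymptotics in
lemma isBigO_sech (hα : 0 < α) :
    (fun x : ℝ => (sech (x * α) : ℂ)) =O[cocompact ℝ] fun x => |x| ^ (-2 : ℝ) := by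
  refine IsBigO.of_bound (4 / α ^ 2) ?_
  have h0 : ∀ᶠ x : ℝ in cocompact ℝ, x ≠ 0 := by
    simpa using (isCompact_singleton (x := (0 : ℝ))).compl_mem_cocompact
  filter_upwards [h0] with x hx
  rw [Complex.norm_real, norm_of_nonneg (sech_pos _).le, rpow_neg (abs_nonneg _), norm_inv,
    norm_of_nonneg (by positivity), rpow_two, sq_abs, sech]
  have h1 := sq_div_four_le_cosh (x * α)
  have h2 : 0 < x ^ 2 := by positivity
  have h3 : 4 / α ^ 2 * (x ^ 2)⁻¹ = ((x * α) ^ 2 / 4)⁻¹ := by field_simp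
  rw [h3]
  exact inv_anti₀ (by positivity) h1

lemma tsum_sech_add (hα : 0 < α) (x : ℝ) :
    ∑' n : ℤ, sech ((x + n) * α) = π / α * dnSeries (π ^ 2 / α) (2 * π * x) := by
  have hs := (summable_sech (show 0 < π ^ 2 / α by positivity)).mul_left (π / α)
  have hF : Summable fun n : ℤ => ((π / α * sech (n * (π ^ 2 / α)) : ℝ) : ℂ) := by
    exact_mod_cast hs
  have h := Real.tsum_eq_tsum_fourier_of_rpow_decay_of_summable
    (f := fun x : ℝ => (sech (x * α) : ℂ))
    (Complex.continuous_ofReal.comp (continuous_sech.comp (continuous_mul_const α)))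
    one_lt_two (isBigO_sech hα) (by simpa only [fourier_sech hα] using hF) x
  simp only [fourier_sech hα, fourier_coe_apply] at h
  have hre (n : ℤ) : (((π / α * sech (n * (π ^ 2 / α)) : ℝ) : ℂ) *
      Complex.exp (2 * π * Complex.I * n * x / (1 : ℝ))).re =
      π / α * (sech (n * (π ^ 2 / α)) * cos (n * (2 * π * x))) := by
    rw [Complex.re_ofReal_mul, show 2 * π * Complex.I * n * x / (1 : ℝ) =
      ((n * (2 * π * x) : ℝ) : ℂ) * Complex.I by push_cast; ring, Complex.exp_ofReal_mul_I_re]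
    ring
  have hS : Summable fun n : ℤ => ((π / α * sech (n * (π ^ 2 / α)) : ℝ) : ℂ) *
      Complex.exp (2 * π * Complex.I * n * x / (1 : ℝ)) := by
    refine Summable.of_norm_bounded hF.norm fun n => ?_
    rw [norm_mul, show 2 * π * Complex.I * n * x / (1 : ℝ) =
      ((n * (2 * π * x) : ℝ) : ℂ) * Complex.I by push_cast; ring,
      Complex.norm_exp_ofReal_mul_I, mul_one]
  have h2 := congrArg Complex.re h
  rw [Complex.re_tsum hS, tsum_congr hre, tsum_mul_left, ← dnSeries_eq, ← Complex.ofReal_tsum,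
    Complex.ofReal_re] at h2
  exact h2

lemma dnSeries_zero_inversion (hα : 0 < α) :
    dnSeries α 0 = π / α * dnSeries (π ^ 2 / α) 0 := by
  have h := tsum_sech_add hα 0
  simp only [zero_add, mul_zero] at h
  rw [← h, dnSeries_eq]
  simp

lemma pi_sq_div_pi_sq_div (hα : 0 < α) : π ^ 2 / (π ^ 2 / α) = α := by
  have := pi_ne_zero
  field_simp

lemma sech_add_le (x y : ℝ) : sech (y + x) ≤ 2 * cosh y * sech x := by
  have h1 := cosh_add (y + x) y
  have h2 := cosh_sub (y + x) y
  rw [add_sub_cancel_left] at h2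
  have h3 : cosh x ≤ 2 * cosh y * cosh (y + x) := by linarith [cosh_pos (y + x + y)]
  rwa [sech, sech, ← div_eq_mul_inv, inv_le_comm₀ (cosh_pos _) (by positivity), inv_div,
    div_le_iff₀' (by positivity)]

lemma summable_sech_add (hα : 0 < α) (x : ℝ) : Summable fun n : ℤ => sech ((x + n) * α) :=
  .of_nonneg_of_le (fun _ => (sech_pos _).le)
    (fun n => by rw [add_mul]; exact sech_add_le _ _)
    ((summable_sech hα).mul_left (2 * cosh (x * α)))

lemma sqMin_pos (hα : 0 < α) : 0 < sqMin α := by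
  have hβ : 0 < π ^ 2 / α := by positivity
  have h := tsum_sech_add hβ (1 / 2)
  rw [pi_sq_div_pi_sq_div hα, show 2 * π * (1 / 2) = π by ring] at h
  have hn : dnSeries α π ≠ 0 := by
    rintro h0
    rw [h0, mul_zero] at h
    exact ((summable_sech_add hβ (1 / 2)).tsum_pos (fun n => (sech_pos _).le) 0 (sech_pos _)).ne' h
  rw [sqMin]
  positivity

/-- The derivative of the inversion `α ↦ π ^ 2 / α`. -/
lemma hasDerivAt_pi_sq_div (hα : 0 < α) :
    HasDerivAt (fun x => π ^ 2 / x) (-(π ^ 2 / α ^ 2)) α :=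
  ((hasDerivAt_inv hα.ne').const_mul (π ^ 2)).congr_deriv (by ring)

lemma sqMax_inversion (hα : 0 < α) : sqMax α = (π ^ 2 / α ^ 2) * sqMax (π ^ 2 / α) := by
  rw [sqMax, sqMax, dnSeries_zero_inversion hα]; ring

lemma hasDerivAt_pi_sq_div_sq (hα : 0 < α) :
    HasDerivAt (fun x => π ^ 2 / x ^ 2) (-(2 * π ^ 2 / α ^ 3)) α := by
  refine (((hasDerivAt_pow 2 α).inv (by positivity)).const_mul (π ^ 2)).congr_deriv ?_
  push_cast
  field_simp

open Filter Topology in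
lemma cschSum_inversion (hα : 0 < α) :
    cschSum α = 2 / α - π ^ 2 / α ^ 2 * cschSum (π ^ 2 / α) := by
  have hβ : 0 < π ^ 2 / α := by positivity
  have h1 := (hasDerivAt_pi_sq_div_sq hα).mul
    ((hasDerivAt_sqMax hβ).comp α (hasDerivAt_pi_sq_div hα))
  have h2 : (fun x => (π ^ 2 / x ^ 2) * sqMax (π ^ 2 / x)) =ᶠ[𝓝 α] sqMax := by
    filter_upwards [lt_mem_nhds hα] with x hx using (sqMax_inversion hx).symm
  have h3 := (hasDerivAt_sqMax hα).unique (h1.congr_of_eventuallyEq h2.symm)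
  have h4 := sqMax_inversion hα
  have h5 := sqMax_pos hβ
  rw [h4] at h3
  have h6 : π ^ 2 / α ^ 2 * sqMax (π ^ 2 / α) ≠ 0 := by positivity
  refine mul_left_cancel₀ h6 ?_
  simp only [Function.comp_apply] at h3
  rw [← neg_inj, h3]
  field_simp
  ring

open Filter Topology in
lemma gapProd_inversion (hα : 0 < α) :
    gapProd α = (π ^ 2 / α ^ 2) ^ 2 * gapProd (π ^ 2 / α) := by
  have hβ : 0 < π ^ 2 / α := by positivity
  have h1 := ((hasDerivAt_inv hα.ne').const_mul 2).sub ((hasDerivAt_pi_sq_div_sq hα).mul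
    ((hasDerivAt_cschSum hβ).comp α (hasDerivAt_pi_sq_div hα)))
  have h2 : (fun x => 2 * x⁻¹ - (π ^ 2 / x ^ 2) * cschSum (π ^ 2 / x)) =ᶠ[𝓝 α] cschSum := by
    filter_upwards [lt_mem_nhds hα] with x hx
    rw [cschSum_inversion hx, div_eq_mul_inv 2 x]
  have h3 := (hasDerivAt_cschSum hα).unique (h1.congr_of_eventuallyEq h2.symm)
  simp only [Function.comp_apply] at h3
  rw [cschSum_inversion hα] at h3
  linear_combination (exp := 1) (-2) * h3

lemma cschSum_pi : cschSum π = 1 / π := by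
  have h := cschSum_inversion pi_pos
  have := pi_ne_zero
  rw [div_self (by positivity), sq, mul_div_assoc, div_self this, mul_one] at h
  linear_combination h / 2

open Filter Topology in
lemma gapDiff_pi : gapDiff π = 0 := by
  have hπ := pi_pos
  have e : π ^ 2 / π = π := by field_simp
  have hβ : HasDerivAt gapProd _ (π ^ 2 / π) := e.symm ▸ hasDerivAt_gapProd hπ
  have h1 := ((hasDerivAt_pi_sq_div_sq hπ).pow 2).mul (hβ.comp π (hasDerivAt_pi_sq_div hπ))
  have h2 : (fun x => (π ^ 2 / x ^ 2) ^ 2 * gapProd (π ^ 2 / x)) =ᶠ[𝓝 π] gapProd := by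
    filter_upwards [lt_mem_nhds hπ] with x hx using (gapProd_inversion hx).symm
  have h3 := (hasDerivAt_gapProd hπ).unique (h1.congr_of_eventuallyEq h2.symm)
  have hs : gapProd π ≠ 0 :=
    (mul_pos (sub_pos.mpr (sqMin_lt_sqMax hπ)) (sqMin_pos hπ)).ne'
  simp only [Function.comp_apply, Pi.pow_apply, e, cschSum_pi,
    div_self (pow_ne_zero 2 pi_ne_zero)] at h3
  push_cast at h3
  field_simp at h3
  have h4 : π * gapDiff π = 0 := by linarith
  exact (mul_eq_zero.mp h4).resolve_left pi_ne_zero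

lemma cos_lt_one_of_mem_Ioo {t : ℝ} (ht : t ∈ Set.Ioo 0 π) : cos t < 1 := by
  rw [← cos_zero]
  exact strictAntiOn_cos (by simp [pi_pos.le]) (Set.Ioo_subset_Icc_self ht) ht.1

lemma neg_one_lt_cos_of_mem_Ioo {t : ℝ} (ht : t ∈ Set.Ioo 0 π) : -1 < cos t := by
  rw [← cos_pi]
  exact strictAntiOn_cos (Set.Ioo_subset_Icc_self ht) (by simp [pi_pos.le]) ht.2

lemma dnSeries_sq_mem_Ioo (hα : 0 < α) {t : ℝ} (ht : t ∈ Set.Ioo 0 π) :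
    dnSeries α t ^ 2 ∈ Set.Ioo (sqMin α) (sqMax α) := by
  have h1 : dnSeries α t ^ 2 < sqMax α := dnSeries_sq_lt hα (cos_lt_one_of_mem_Ioo ht)
  have h2 : dnSeries α (t + π) ^ 2 < sqMax α := dnSeries_sq_lt hα (by
    rw [cos_add_pi]; linarith [neg_one_lt_cos_of_mem_Ioo ht])
  refine ⟨?_, h1⟩
  have h3 : dnSeries α t ^ 2 * dnSeries α (t + π) ^ 2 = sqMin α * sqMax α := by
    rw [← mul_pow, dnSeries_mul_add_pi hα, mul_pow, sqMin, sqMax, mul_comm]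
  by_contra! h4
  have := mul_le_mul h4 h2.le (sq_nonneg _) (sqMin_pos hα).le
  nlinarith [sqMin_pos hα, sq_nonneg (dnSeries α (t + π)), mul_le_mul_of_nonneg_right h4
    (sq_nonneg (dnSeries α (t + π))), mul_lt_mul_of_pos_left h2 (sqMin_pos hα)]

lemma deriv_dnSeries_sq_sq (hα : 0 < α) (t : ℝ) :
    (2 * (dnSeries α t * dnSeriesDeriv α t)) ^ 2 = dnSeries α t ^ 2 *
      ((sqMax α - dnSeries α t ^ 2) * (dnSeries α t ^ 2 - sqMin α)) := by
  linear_combination 4 * dnSeries α t ^ 2 * dnSeriesDeriv_sq hα t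

lemma deriv_dnSeries_sq_ne_zero (hα : 0 < α) {t : ℝ} (ht : t ∈ Set.Ioo 0 π) :
    2 * (dnSeries α t * dnSeriesDeriv α t) ≠ 0 := by
  have h := dnSeries_sq_mem_Ioo hα ht
  rw [← sq_pos_iff, deriv_dnSeries_sq_sq hα]
  exact mul_pos ((sqMin_pos hα).trans h.1)
    (mul_pos (sub_pos.mpr h.2) (sub_pos.mpr h.1))

lemma continuous_dnSeries (hα : 0 < α) : Continuous (dnSeries α) :=
  continuous_iff_continuousAt.mpr fun t => (hasDerivAt_dnSeries hα t).continuousAt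

lemma injOn_dnSeries_sq (hα : 0 < α) :
    Set.InjOn (fun t => dnSeries α t ^ 2) (Set.Ioo 0 π) := by
  have key : ∀ x ∈ Set.Ioo 0 π, ∀ y ∈ Set.Ioo 0 π, x < y →
      dnSeries α x ^ 2 ≠ dnSeries α y ^ 2 := by
    intro x hx y hy hxy he
    obtain ⟨z, hz, h⟩ := exists_hasDerivAt_eq_zero hxy
      ((continuous_dnSeries hα).pow 2).continuousOn he
      (fun t _ => hasDerivAt_dnSeries_sq hα t)
    exact deriv_dnSeries_sq_ne_zero hα ⟨hx.1.trans hz.1, hz.2.trans hy.2⟩ h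
  intro x hx y hy he
  rcases lt_trichotomy x y with h | h | h
  · exact absurd he (key x hx y hy h)
  · exact h
  · exact absurd he.symm (key y hy x hx h)

lemma image_dnSeries_sq (hα : 0 < α) :
    (fun t => dnSeries α t ^ 2) '' Set.Ioo 0 π = Set.Ioo (sqMin α) (sqMax α) := by
  refine Set.Subset.antisymm ?_ ?_
  · rintro _ ⟨t, ht, rfl⟩
    exact dnSeries_sq_mem_Ioo hα ht
  · exact intermediate_value_Ioo' pi_pos.le ((continuous_dnSeries hα).pow 2).continuousOn

/-- The change of variables turning the `dnSeries` into an integrand of the beta integral. -/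
noncomputable def betaVar (c v : ℝ) : ℝ := (2 * v / c - 1) ^ 2

lemma hasDerivAt_betaVar (c v : ℝ) :
    HasDerivAt (betaVar c) (4 * (2 * v / c - 1) / c) v :=
  (((((hasDerivAt_id v).const_mul 2).div_const c).sub_const 1).pow 2).congr_deriv (by
    simp only [id]; push_cast; ring)

lemma betaVar_base_mem {c v : ℝ} (hc : 0 < c) (hv : v ∈ Set.Ioo (c / 2) c) :
    2 * v / c - 1 ∈ Set.Ioo 0 1 := by
  have h1 := hv.1
  have h2 := hv.2
  constructor
  · rw [sub_pos, lt_div_iff₀ hc]; linarith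
  · rw [sub_lt_iff_lt_add, div_lt_iff₀ hc]; linarith

lemma image_betaVar {c : ℝ} (hc : 0 < c) :
    betaVar c '' Set.Ioo (c / 2) c = Set.Ioo 0 1 := by
  refine Set.Subset.antisymm ?_ ?_
  · rintro _ ⟨v, hv, rfl⟩
    have h := betaVar_base_mem hc hv
    exact ⟨pow_pos h.1 2, pow_lt_one₀ h.1.le h.2 two_ne_zero⟩
  · have hcont : Continuous (betaVar c) :=
      continuous_iff_continuousAt.mpr fun v => (hasDerivAt_betaVar c v).continuousAt
    have h := intermediate_value_Ioo (half_le_self hc.le) hcont.continuousOn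
    rwa [betaVar, betaVar, mul_div_cancel₀ _ two_ne_zero, mul_div_cancel_right₀ _ hc.ne',
      div_self hc.ne', show ((1 : ℝ) - 1) ^ 2 = 0 by norm_num,
      show ((2 : ℝ) - 1) ^ 2 = 1 by norm_num] at h

lemma injOn_betaVar {c : ℝ} (hc : 0 < c) : Set.InjOn (betaVar c) (Set.Ioo (c / 2) c) := by
  intro v hv w hw h
  have h1 := (pow_left_inj₀ (betaVar_base_mem hc hv).1.le (betaVar_base_mem hc hw).1.le
    two_ne_zero).mp h
  field_simp at h1
  linarith

lemma betaVar_integrand {r k d : ℝ} (hr : r ∈ Set.Ioo 0 1)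
    (hd : d ^ 2 = k * (r ^ 3 * (1 - r ^ 2))) :
    |d| * ((r ^ 2) ^ (1 / 4 - 1 : ℝ) * (1 - r ^ 2) ^ (1 / 2 - 1 : ℝ)) = √k := by
  have h0 := hr.1
  have h1 : 0 < 1 - r ^ 2 := sub_pos.mpr (pow_lt_one₀ hr.1.le hr.2 two_ne_zero)
  have e1 : ((r ^ 2) ^ (1 / 4 - 1 : ℝ)) ^ 2 = (r ^ 3)⁻¹ := by
    rw [← rpow_natCast, ← rpow_mul (by positivity), ← rpow_natCast, ← rpow_mul h0.le,
      ← rpow_natCast, ← rpow_neg h0.le]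
    norm_num
  have e2 : ((1 - r ^ 2) ^ (1 / 2 - 1 : ℝ)) ^ 2 = (1 - r ^ 2)⁻¹ := by
    rw [← rpow_natCast, ← rpow_mul h1.le, ← rpow_neg_one]
    norm_num
  have e3 : 0 ≤ |d| * ((r ^ 2) ^ (1 / 4 - 1 : ℝ) * (1 - r ^ 2) ^ (1 / 2 - 1 : ℝ)) :=
    mul_nonneg (abs_nonneg d) (mul_nonneg (by positivity) (rpow_nonneg h1.le _))
  rw [← sqrt_sq e3, mul_pow, mul_pow, sq_abs, hd, e1, e2]
  congr 1
  field_simp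

lemma deriv_betaVar_dnSeries_sq (hα : 0 < α) (hd : gapDiff α = 0) (t : ℝ) :
    (4 * (2 * dnSeries α t ^ 2 / sqMax α - 1) / sqMax α *
        (2 * (dnSeries α t * dnSeriesDeriv α t))) ^ 2 =
      2 * sqMax α * ((2 * dnSeries α t ^ 2 / sqMax α - 1) ^ 3 *
        (1 - (2 * dnSeries α t ^ 2 / sqMax α - 1) ^ 2)) := by
  have hc := sqMax_pos hα
  have hb : sqMin α = sqMax α / 2 := by rw [gapDiff] at hd; linarith
  rw [mul_pow, deriv_dnSeries_sq_sq hα, hb]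
  generalize dnSeries α t ^ 2 = v
  field_simp
  ring

open MeasureTheory Set in
lemma betaIntegral_eq_sqrt_sqMax (hα : 0 < α) (hd : gapDiff α = 0) :
    Complex.betaIntegral (1 / 4) (1 / 2) = (π * √(2 * sqMax α) : ℝ) := by
  have hc := sqMax_pos hα
  have hb : sqMin α = sqMax α / 2 := by rw [gapDiff] at hd; linarith
  have hI := image_dnSeries_sq hα
  rw [hb] at hI
  have hmaps : MapsTo (fun t => dnSeries α t ^ 2) (Ioo 0 π) (Ioo (sqMax α / 2) (sqMax α)) :=
    fun t ht => hI ▸ mem_image_of_mem _ ht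
  have himage : (fun t => betaVar (sqMax α) (dnSeries α t ^ 2)) '' Ioo 0 π = Ioo 0 1 := by
    rw [← image_betaVar hc, ← hI, image_image]
  have h := integral_image_eq_integral_abs_deriv_smul measurableSet_Ioo
    (fun t _ => ((hasDerivAt_betaVar (sqMax α) (dnSeries α t ^ 2)).comp t
      (hasDerivAt_dnSeries_sq hα t)).hasDerivWithinAt)
    ((injOn_betaVar hc).comp (injOn_dnSeries_sq hα) hmaps)
    (fun y : ℝ => (y : ℂ) ^ (1 / 4 - 1 : ℂ) * (1 - (y : ℂ)) ^ (1 / 2 - 1 : ℂ))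
  rw [show (betaVar (sqMax α) ∘ fun t => dnSeries α t ^ 2) '' Ioo 0 π = Ioo 0 1 from himage] at h
  rw [Complex.betaIntegral, intervalIntegral.integral_of_le zero_le_one,
    integral_Ioc_eq_integral_Ioo, h]
  have hconst : ∫ _ in Ioo 0 π, ((√(2 * sqMax α) : ℝ) : ℂ) = (π * √(2 * sqMax α) : ℝ) := by
    rw [setIntegral_const, Real.volume_real_Ioo_of_le pi_pos.le, sub_zero, Complex.real_smul]
    push_cast
    rfl
  rw [← hconst]
  refine setIntegral_congr_fun measurableSet_Ioo fun t ht => ?_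
  have hr := betaVar_base_mem hc (hmaps ht)
  have hm : 0 < 1 - betaVar (sqMax α) (dnSeries α t ^ 2) :=
    sub_pos.mpr (pow_lt_one₀ hr.1.le hr.2 two_ne_zero)
  have hv := betaVar_integrand hr (deriv_betaVar_dnSeries_sq hα hd t)
  simp only [Function.comp_apply]
  rw [← hv, Complex.real_smul, ← betaVar]
  push_cast
  rw [Complex.ofReal_cpow (show 0 ≤ betaVar (sqMax α) (dnSeries α t ^ 2) from sq_nonneg _),
    Complex.ofReal_cpow hm.le]
  push_cast
  rfl

lemma sqMax_eq_Gamma (hα : 0 < α) (hd : gapDiff α = 0) :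
    sqMax α = Gamma (1 / 4) ^ 4 / (4 * π ^ 3) := by
  have hπ := pi_pos
  have h1 := Complex.Gamma_mul_Gamma_eq_betaIntegral (s := 1 / 4) (t := 1 / 2)
    (by norm_num) (by norm_num)
  rw [betaIntegral_eq_sqrt_sqMax hα hd, show (1 / 4 : ℂ) = ((1 / 4 : ℝ) : ℂ) by norm_num,
    show (1 / 2 : ℂ) = ((1 / 2 : ℝ) : ℂ) by norm_num, ← Complex.ofReal_add,
    Complex.Gamma_ofReal, Complex.Gamma_ofReal, Complex.Gamma_ofReal,
    ← Complex.ofReal_mul, ← Complex.ofReal_mul, Complex.ofReal_inj, Real.Gamma_one_half_eq] at h1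
  have h2 := Real.Gamma_mul_Gamma_one_sub (1 / 4)
  rw [show (1 : ℝ) - 1 / 4 = 1 / 4 + 1 / 2 by norm_num, show π * (1 / 4) = π / 4 by ring,
    sin_pi_div_four] at h2
  have h3 : (Gamma (1 / 4) ^ 2 * √π) ^ 2 = (π / (√2 / 2) * (π * √(2 * sqMax α))) ^ 2 := by
    rw [← h2]
    congr 1
    linear_combination Gamma (1 / 4) * h1
  simp only [mul_pow, div_pow] at h3
  rw [sq_sqrt hπ.le, sq_sqrt zero_le_two, sq_sqrt (by linarith [sqMax_pos hα])] at h3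
  rw [eq_div_iff (by positivity)]
  refine mul_right_cancel₀ hπ.ne' ?_
  linear_combination -h3

lemma coth_sq {x : ℝ} (hx : x ≠ 0) : coth x ^ 2 = csch x ^ 2 + 1 := by
  have hx' : sinh x ≠ 0 := by rwa [Ne, sinh_eq_zero]
  rw [coth, csch]
  field_simp
  linear_combination cosh_sq x

lemma hasDerivAt_coth {x : ℝ} (hx : x ≠ 0) : HasDerivAt coth (1 - coth x ^ 2) x := by
  have hx' : sinh x ≠ 0 := by rwa [Ne, sinh_eq_zero]
  refine ((hasDerivAt_cosh x).div (hasDerivAt_sinh x) hx').congr_deriv ?_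
  rw [coth]
  field_simp

/-- The derivative of `csch`. -/
noncomputable def cschDeriv (x : ℝ) : ℝ := -1 * (csch x * coth x)

/-- The second derivative of `csch`. -/
noncomputable def cschDerivTwo (x : ℝ) : ℝ := 2 * (csch x * coth x * coth x) + -1 * csch x

/-- The third derivative of `csch`. -/
noncomputable def cschDerivThree (x : ℝ) : ℝ :=
  -6 * (csch x * coth x * coth x * coth x) + 5 * (csch x * coth x)

lemma hasDerivAt_cschDeriv {x : ℝ} (hx : x ≠ 0) : HasDerivAt cschDeriv (cschDerivTwo x) x := by
  refine (((hasDerivAt_csch hx).mul (hasDerivAt_coth hx)).const_mul (-1)).congr_deriv ?_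
  rw [cschDerivTwo]
  ring

lemma hasDerivAt_cschDerivTwo {x : ℝ} (hx : x ≠ 0) :
    HasDerivAt cschDerivTwo (cschDerivThree x) x := by
  have h1 := hasDerivAt_csch hx
  have h2 := hasDerivAt_coth hx
  refine ((((h1.mul h2).mul h2).const_mul 2).add (h1.const_mul (-1))).congr_deriv ?_
  simp only [cschDerivThree, Pi.mul_apply]
  ring

lemma expDecay_cschDeriv : ExpDecay cschDeriv := expDecay_csch_mul_coth.const_mul (-1)

lemma expDecay_cschDerivTwo : ExpDecay cschDerivTwo :=
  ((expDecay_csch_mul_coth.mul_bdd bddAway_coth).const_mul 2).add (expDecay_csch.const_mul (-1))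

lemma expDecay_cschDerivThree : ExpDecay cschDerivThree :=
  (((expDecay_csch_mul_coth.mul_bdd bddAway_coth).mul_bdd bddAway_coth).const_mul (-6)).add
    (expDecay_csch_mul_coth.const_mul 5)

lemma cschDeriv_sub_cschDerivThree (x : ℝ) :
    cschDeriv x - cschDerivThree x = 6 * (cosh x / sinh x ^ 4) := by
  rcases eq_or_ne x 0 with rfl | hx
  · simp [cschDeriv, cschDerivThree, csch_zero]
  have h : cschDeriv x - cschDerivThree x = 6 * (csch x ^ 3 * coth x) := by
    rw [cschDeriv, cschDerivThree]
    linear_combination 6 * csch x * coth x * coth_sq hx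
  have hx' : sinh x ≠ 0 := by rwa [Ne, sinh_eq_zero]
  rw [h, csch, coth]
  field_simp

lemma cosSeries_cschDeriv_four (hα : 0 < α) :
    cosSeries cschDeriv 4 α π = gapProd α * (2 * cschSum α + gapDiff α) / 4 := by
  have h := hasDerivAt_cosSeries_param expDecay_csch expDecay_cschDeriv
    (fun x hx => hasDerivAt_csch hx) 3 π hα
  refine h.unique ((((hasDerivAt_gapProd hα).neg.div_const 4).congr_deriv
    (by ring)).congr_of_eventuallyEq ?_)
  filter_upwards [lt_mem_nhds hα] with x hx using cosSeries_csch_three_pi hx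

lemma cosSeries_cschDeriv_six (hα : 0 < α) :
    cosSeries cschDeriv 6 α π =
      (gapProd α * (2 * cschSum α + gapDiff α) * gapDiff α -
        gapProd α * (2 * gapProd α - gapDiff α * cschSum α)) / 4 := by
  have h := hasDerivAt_cosSeries_param expDecay_csch expDecay_cschDeriv
    (fun x hx => hasDerivAt_csch hx) 5 π hα
  refine h.unique (((((hasDerivAt_gapProd hα).mul (hasDerivAt_gapDiff hα)).neg.div_const
    4).congr_deriv (by ring)).congr_of_eventuallyEq ?_)
  filter_upwards [lt_mem_nhds hα] with x hx
  rw [cosSeries_csch_five_pi hx]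
  simp only [Pi.neg_apply, Pi.mul_apply, gapProd, gapDiff]
  ring

lemma cosSeries_cschDerivTwo_five (hα : 0 < α) :
    cosSeries cschDerivTwo 5 α π =
      -(gapProd α * (5 * cschSum α ^ 2 + 5 * cschSum α * gapDiff α + gapDiff α ^ 2 -
        gapProd α)) / 4 := by
  have h := hasDerivAt_cosSeries_param expDecay_cschDeriv expDecay_cschDerivTwo
    (fun x hx => hasDerivAt_cschDeriv hx) 4 π hα
  have hs := hasDerivAt_gapProd hα
  have hd := hasDerivAt_gapDiff hα
  have hp := hasDerivAt_cschSum hα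
  refine h.unique ((((hs.mul ((hp.const_mul 2).add hd)).div_const 4).congr_deriv
    ?_).congr_of_eventuallyEq ?_)
  · simp only [Pi.add_apply]
    ring
  filter_upwards [lt_mem_nhds hα] with x hx using cosSeries_cschDeriv_four hx

lemma cosSeries_cschDerivThree_six (hα : 0 < α) (h0 : gapDiff α = 0) :
    cosSeries cschDerivThree 6 α π =
      gapProd α * (15 * cschSum α ^ 3 - 9 * cschSum α * gapProd α) / 4 := by
  have h := hasDerivAt_cosSeries_param expDecay_cschDerivTwo expDecay_cschDerivThree
    (fun x hx => hasDerivAt_cschDerivTwo hx) 5 π hα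
  have hs := hasDerivAt_gapProd hα
  have hd := hasDerivAt_gapDiff hα
  have hp := hasDerivAt_cschSum hα
  have h1 := (((hp.pow 2).const_mul 5).add ((hp.const_mul 5).mul hd)).add (hd.pow 2)
  refine h.unique ((((hs.mul (h1.sub hs)).neg.div_const 4).congr_deriv
    ?_).congr_of_eventuallyEq ?_)
  · simp only [Pi.add_apply, Pi.sub_apply, Pi.mul_apply, Pi.pow_apply, h0]
    push_cast
    ring
  filter_upwards [lt_mem_nhds hα] with x hx using cosSeries_cschDerivTwo_five hx

lemma six_mul_cosSeries_cosh_div_sinh_pow (k : ℕ) (hα : 0 < α) (t : ℝ) :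
    6 * cosSeries (fun x => cosh x / sinh x ^ 4) k α t =
      cosSeries cschDeriv k α t - cosSeries cschDerivThree k α t := by
  rw [← cosSeries_const_mul, cosSeries, cosSeries, cosSeries,
    ← Summable.tsum_sub (summable_mul_cos (expDecay_cschDeriv.summable k hα) t)
      (summable_mul_cos (expDecay_cschDerivThree.summable k hα) t)]
  refine tsum_congr fun n => ?_
  rw [← cschDeriv_sub_cschDerivThree]
  ring

lemma summable_cosh_div_sinh_pow (k : ℕ) (hα : 0 < α) :
    Summable fun n : ℤ => (n : ℝ) ^ k * (cosh (n * α) / sinh (n * α) ^ 4) := by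
  refine (((expDecay_cschDeriv.summable k hα).sub
    (expDecay_cschDerivThree.summable k hα)).mul_left (1 / 6)).congr fun n => ?_
  rw [← mul_sub, cschDeriv_sub_cschDerivThree]
  ring

lemma cosSeries_cosh_div_sinh_pow_pi (hα : 0 < α) :
    cosSeries (fun x => cosh x / sinh x ^ 4) 6 α π =
      2 * ∑' n : ℕ, (-1 : ℝ) ^ (n + 1) * ((n : ℝ) + 1) ^ 6 * cosh (((n : ℝ) + 1) * α) /
        sinh (((n : ℝ) + 1) * α) ^ 4 := by
  have he : Function.Even fun n : ℤ =>
      (n : ℝ) ^ 6 * (cosh (n * α) / sinh (n * α) ^ 4) * cos (n * π) := by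
    intro n
    simp only [Int.cast_neg, neg_mul, cosh_neg, sinh_neg, cos_neg,
      (by decide : Even 6).neg_pow, (by decide : Even 4).neg_pow]
  have h := tsum_int_eq_zero_add_two_mul_tsum_pnat he
    (summable_mul_cos (summable_cosh_div_sinh_pow 6 hα) π)
  rw [cosSeries, h, tsum_pnat_eq_tsum_succ (f := fun n : ℕ => ((n : ℤ) : ℝ) ^ 6 *
      (cosh (((n : ℤ) : ℝ) * α) / sinh (((n : ℤ) : ℝ) * α) ^ 4) * cos (((n : ℤ) : ℝ) * π)),
    Int.cast_zero, zero_pow (by norm_num), zero_mul, zero_mul, zero_add,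
    nsmul_eq_mul, Nat.cast_ofNat]
  congr 1
  refine tsum_congr fun n => ?_
  rw [← cos_nat_mul_pi]
  push_cast
  ring

end SechSeries

open SechSeries in
theorem sum_n6_cosh_sinh_fourth :
    (∑' n : ℕ, (-1 : ℝ) ^ (n+1) * ((n:ℝ)+1) ^ 6 * Real.cosh (((n:ℝ)+1) * π)
        / Real.sinh (((n:ℝ)+1) * π) ^ 4) =
      3 * Real.Gamma (1/4) ^ 16 / (2 ^ 16 * π ^ 13)
    - Real.Gamma (1/4) ^ 16 / (3 * 2 ^ 15 * π ^ 12)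
    - 5 * Real.Gamma (1/4) ^ 8 / (2 ^ 10 * π ^ 9) := by
  have h1 := six_mul_cosSeries_cosh_div_sinh_pow 6 pi_pos π
  rw [cosSeries_cosh_div_sinh_pow_pi pi_pos, cosSeries_cschDeriv_six pi_pos,
    cosSeries_cschDerivThree_six pi_pos gapDiff_pi, gapDiff_pi, cschSum_pi] at h1
  have hs : gapProd π = Gamma (1 / 4) ^ 8 / (64 * π ^ 6) := by
    have hd := gapDiff_pi
    rw [gapDiff] at hd
    rw [gapProd, show sqMin π = sqMax π / 2 by linarith, sqMax_eq_Gamma pi_pos gapDiff_pi]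
    field_simp
    ring
  rw [hs] at h1
  have hπ := pi_ne_zero
  refine mul_left_cancel₀ (show (12 : ℝ) ≠ 0 by norm_num) ?_
  refine Eq.trans (by ring) (h1.trans ?_)
  field_simp
  ring
end
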